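/- Let 0 < a < 1/2 and k ≥ 1. Define polynomials q₁(t) = t and q_{k+1}(t) = t·q_k(t) − q_k'(t); let t₁ < t₂ < ⋯ < t_k be the zeros of q_k, and set t̃_i := t_i·√(2a(1−2a)) for 1 ≤ i ≤ k. For x ∈ (0,1) set δ_*(x) := liminf_{n→∞} ((1−2a)n − l_n(x))/√n and δ*(x) := limsup_{n→∞} ((1−2a)n − l_n(x))/√n, and say condition (★) holds at x if 3ⁿ·a^{n−l_n(x)}·(1−2a)^{l_n(x)} ≥ 1 for all sufficiently large n. Then: (a) if δ*(x) < t̃₁ and (★) holds, then M_{k,a}'(x) = (−1)^k·∞; (b) if t̃_i < δ_*(x) ≤ δ*(x) < t̃_{i+1} for some i ∈ {1,…,k−1}, then M_{k,a}'(x) = +∞ if k−i is even and M_{k,a}'(x) = −∞ if k−i is odd; (c) if δ_*(x) > t̃_k and (★) holds, then M_{k,a}'(x) = +∞; (d) if δ*(x) < t̃_i < δ_*(x) for some i ∈ {1,…,k} [sic: the roles of liminf and limsup are that δ_*(x) < t̃_i < δ*(x)], then M_{k,a} does not have an infinite derivative at x. -/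

import Mathlib

open Filter Topology MeasureTheory Set
open scoped ENNReal

/-- The `(n+1)`-th ternary digit of `x` (choosing the expansion ending in all `0`s
when two expansions exist, and the all-`2`s expansion for `x = 1`). -/
noncomputable def tDigit (x : ℝ) (n : ℕ) : ℕ :=
  if x = 1 then 2 else (⌊(3:ℝ) ^ (n + 1) * x⌋ - 3 * ⌊(3:ℝ) ^ n * x⌋).toNat

/-- `l_n(x)`: the number of `1`s among the first `n` ternary digits of `x`. -/
noncomputable def lCount (x : ℝ) (n : ℕ) : ℕ :=
  ((Finset.range n).filter (fun i => tDigit x i = 1)).card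

/-- `q_a(d)` with `q_a(0)=0`, `q_a(1)=a`, `q_a(2)=1-a`. -/
noncomputable def qDig (a : ℝ) (d : ℕ) : ℝ :=
  if d = 0 then 0 else if d = 1 then a else 1 - a

/-- Okamoto's function `F_a`. -/
noncomputable def Okamoto (a x : ℝ) : ℝ :=
  ∑' n : ℕ, a ^ (n - lCount x n) * (1 - 2 * a) ^ lCount x n * qDig a (tDigit x n)

/-- `M_{k,a}(x)`: the `k`-th partial derivative of `F_a(x)` with respect to `a`. -/
noncomputable def Mfun (k : ℕ) (a x : ℝ) : ℝ :=
  iteratedDeriv k (fun b => Okamoto b x) a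

/-- `f` has derivative `+∞` at `x` (difference quotients over `y ∈ [0,1] \ {x}`). -/
def derivPInf (f : ℝ → ℝ) (x : ℝ) : Prop :=
  Tendsto (fun y => (f y - f x) / (y - x)) (𝓝[Set.Icc 0 1 \ {x}] x) atTop

/-- `f` has derivative `-∞` at `x`. -/
def derivMInf (f : ℝ → ℝ) (x : ℝ) : Prop :=
  Tendsto (fun y => (f y - f x) / (y - x)) (𝓝[Set.Icc 0 1 \ {x}] x) atBot

noncomputable def phiOk (a : ℝ) : ℝ :=
  if a = 1/3 then 1/3 else if a = 1/2 then 0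
  else Real.log (3 * a) / (Real.log a - Real.log |1 - 2 * a|)

noncomputable def C0 (a : ℝ) : ℝ := 1 / (Real.log a - Real.log |1 - 2 * a|)

noncomputable def hEnt (p : ℝ) : ℝ :=
  (-(p * Real.log p) - (1 - p) * Real.log (1 - p) + (1 - p) * Real.log 2) / Real.log 3

noncomputable def dOk (a : ℝ) : ℝ := hEnt (phiOk a)

noncomputable def dTilde (a : ℝ) : ℝ := hEnt (1 - 2 * a)

/-- The polynomials `q₁(t) = t`, `q_{k+1}(t) = t q_k(t) - q_k'(t)`. -/
noncomputable def qPoly : ℕ → Polynomial ℝ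
  | 0 => 1
  | 1 => Polynomial.X
  | (k + 2) => Polynomial.X * qPoly (k + 1) - Polynomial.derivative (qPoly (k + 1))

/-- The normalized deviation `((1-2a)n - l_n(x))/√n`, as an extended real. -/
noncomputable def devSeq (a x : ℝ) (n : ℕ) : EReal :=
  ((((1 - 2 * a) * n - lCount x n) / Real.sqrt n : ℝ) : EReal)

/-- Condition (★): `3^n a^{n-l_n(x)} (1-2a)^{l_n(x)} ≥ 1` for all sufficiently large `n`. -/
def condStar (a x : ℝ) : Prop :=
  ∀ᶠ n in atTop, (1:ℝ) ≤ 3 ^ n * a ^ (n - lCount x n) * (1 - 2 * a) ^ lCount x n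

/-- The polynomial `b ↦ b ^ (n - l) * (1 - 2 * b) ^ l`: the increment of `F_b` over a triadic
interval of level `n` whose address contains `l` digits equal to `1`. -/
noncomputable def cylPoly (n l : ℕ) : Polynomial ℝ :=
  Polynomial.X ^ (n - l) * (1 - 2 * Polynomial.X) ^ l

lemma eval_cylPoly (n l : ℕ) (b : ℝ) :
    (cylPoly n l).eval b = b ^ (n - l) * (1 - 2 * b) ^ l := by
  simp [cylPoly]

lemma eval_cylPoly_pos (n l : ℕ) {a : ℝ} (ha : 0 < a) (ha' : a < 1 / 2) :
    0 < (cylPoly n l).eval a := by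
  rw [eval_cylPoly]
  have : 0 < 1 - 2 * a := by linarith
  positivity

lemma X_mul_derivative_X_pow (m : ℕ) :
    Polynomial.X * Polynomial.derivative (Polynomial.X ^ m : Polynomial ℝ)
      = (m : Polynomial ℝ) * Polynomial.X ^ m := by
  rcases m with _ | m
  · simp
  · simp only [Polynomial.derivative_X_pow, Polynomial.C_eq_natCast]
    simp only [Nat.add_sub_cancel]
    ring

lemma mul_derivative_one_sub_pow (l : ℕ) :
    (1 - 2 * Polynomial.X) *
        Polynomial.derivative ((1 - 2 * Polynomial.X) ^ l : Polynomial ℝ)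
      = -2 * (l : Polynomial ℝ) * (1 - 2 * Polynomial.X) ^ l := by
  have h2 : Polynomial.derivative (2 : Polynomial ℝ) = 0 := by
    simp
  rcases l with _ | l
  · simp
  · simp only [Polynomial.derivative_pow, Polynomial.derivative_sub, Polynomial.derivative_mul,
      Polynomial.derivative_one, Polynomial.derivative_X, h2, Polynomial.C_eq_natCast]
    simp only [Nat.add_sub_cancel]
    ring

lemma cylPoly_derivative (n l : ℕ) (hl : l ≤ n) :
    Polynomial.X * (1 - 2 * Polynomial.X) * Polynomial.derivative (cylPoly n l)
      = ((1 - 2 * Polynomial.X) * (n : Polynomial ℝ) - (l : Polynomial ℝ)) * cylPoly n l := by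
  obtain ⟨m, rfl⟩ := Nat.exists_eq_add_of_le' hl
  have h1 := X_mul_derivative_X_pow m
  have h2 := mul_derivative_one_sub_pow l
  simp only [cylPoly, Nat.add_sub_cancel, Polynomial.derivative_mul]
  push_cast
  linear_combination (1 - 2 * Polynomial.X) * (1 - 2 * Polynomial.X) ^ l * h1
    + Polynomial.X * Polynomial.X ^ m * h2

lemma cylPoly_iterate_derivative (n l : ℕ) (hl : l ≤ n) (k : ℕ) :
    Polynomial.X * (1 - 2 * Polynomial.X) * Polynomial.derivative^[k + 2] (cylPoly n l)
      = ((1 - 2 * Polynomial.X) * (n : Polynomial ℝ) - (l : Polynomial ℝ)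
          - ((k : Polynomial ℝ) + 1) * (1 - 4 * Polynomial.X))
            * Polynomial.derivative^[k + 1] (cylPoly n l)
        - 2 * ((k : Polynomial ℝ) + 1) * ((n : Polynomial ℝ) - (k : Polynomial ℝ))
            * Polynomial.derivative^[k] (cylPoly n l) := by
  have h2 : Polynomial.derivative (2 : Polynomial ℝ) = 0 := by
    simp
  have h4 : Polynomial.derivative (4 : Polynomial ℝ) = 0 := by
    simp
  induction k with
  | zero =>
    have h := congrArg Polynomial.derivative (cylPoly_derivative n l hl)
    simp only [Polynomial.derivative_mul, Polynomial.derivative_sub, Polynomial.derivative_one,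
      Polynomial.derivative_X, Polynomial.derivative_natCast, h2] at h
    simp only [Function.iterate_succ', Function.comp, Function.iterate_zero, id]
    push_cast
    linear_combination h
  | succ k ih =>
    have h := congrArg Polynomial.derivative ih
    simp only [Polynomial.derivative_mul, Polynomial.derivative_sub, Polynomial.derivative_one,
      Polynomial.derivative_X, Polynomial.derivative_natCast, h2, h4, Polynomial.derivative_add,
      ← Function.iterate_succ_apply' Polynomial.derivative] at h
    push_cast
    linear_combination h

lemma abs_three_term_bound (w e : ℝ) (hw : 0 < w) (k : ℕ) : ∃ C : ℝ, 0 < C ∧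
    ∀ (n D : ℝ) (h g : ℕ → ℝ), 1 ≤ n → h 0 = 1 → g 0 = 1 → w * h 1 = D → w * g 1 = D →
      (∀ j : ℕ, w * h (j + 2) = (D - (j + 1) * e) * h (j + 1) - 2 * (j + 1) * (n - j) * h j) →
      (∀ j : ℕ, w * g (j + 2) = D * g (j + 1) - 2 * (j + 1) * n * g j) →
      |h k| ≤ C * (√n + |D|) ^ k ∧ (√n + |D|) * |h k - g k| ≤ C * (√n + |D|) ^ k := by
  induction k using Nat.twoStepInduction with
  | zero =>
    refine ⟨1, one_pos, fun n D h g hn h0 g0 _ _ _ _ => ?_⟩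
    simp [h0, g0]
  | one =>
    refine ⟨1 / w, by positivity, fun n D h g hn h0 g0 h1 g1 _ _ => ?_⟩
    have e1 : h 1 = D / w := by field_simp; linarith
    have e2 : g 1 = D / w := by field_simp; linarith
    have := Real.sqrt_nonneg n
    rw [e1, e2, abs_div, abs_of_pos hw]
    constructor
    · rw [pow_one, div_mul_eq_mul_div, one_mul]
      gcongr; linarith
    · simp only [sub_self, abs_zero, mul_zero]; positivity
  | more k ih0 ih1 =>
    obtain ⟨C0, hC0, H0⟩ := ih0
    obtain ⟨C1, hC1, H1⟩ := ih1
    refine ⟨(C1 * (1 + (k + 1) * |e|) + 2 * (k + 1) * (1 + k) * C0) / w, by positivity,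
      fun n D h g hn h0 g0 h1 g1 hh gg => ?_⟩
    obtain ⟨A0, B0⟩ := H0 n D h g hn h0 g0 h1 g1 hh gg
    obtain ⟨A1, B1⟩ := H1 n D h g hn h0 g0 h1 g1 hh gg
    have hs : 1 ≤ √n := Real.one_le_sqrt.2 hn
    set T := √n + |D| with hT
    have hT1 : 1 ≤ T := by have := abs_nonneg D; linarith
    have hDT : |D| ≤ T := by linarith
    have hnT : n ≤ T ^ 2 := by
      have : √n ^ 2 = n := Real.sq_sqrt (by linarith)
      rw [← this]; have := abs_nonneg D; gcongr; linarith
    have hnk : |n - k| ≤ (1 + k) * T ^ 2 := by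
      have hk0 : (0:ℝ) ≤ k := Nat.cast_nonneg k
      have h1T : 1 ≤ T ^ 2 := one_le_pow₀ hT1
      calc |n - k| ≤ |n| + |(k:ℝ)| := abs_sub _ _
        _ = n + k := by rw [abs_of_nonneg (by linarith), abs_of_nonneg hk0]
        _ ≤ (1 + k) * T ^ 2 := by nlinarith
    constructor
    · have e1 : w * |h (k + 2)| ≤ (C1 * (1 + (k + 1) * |e|) + 2 * (k + 1) * (1 + k) * C0) * T ^ (k + 2) := by
        have e0 : w * |h (k + 2)| = |w * h (k + 2)| := by rw [abs_mul, abs_of_pos hw]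
        rw [e0, hh k]
        have hx : |(D - (k + 1) * e)| ≤ (1 + (k + 1) * |e|) * T := by
          calc |(D - (k + 1) * e)| ≤ |D| + |(k + 1) * e| := abs_sub _ _
            _ = |D| + (k + 1) * |e| := by rw [abs_mul, abs_of_nonneg (by positivity : (0:ℝ) ≤ k + 1)]
            _ ≤ _ := by have : 0 ≤ (k + 1) * |e| := by positivity
                        nlinarith
        calc |(D - (k + 1) * e) * h (k + 1) - 2 * (k + 1) * (n - k) * h k|
            ≤ |(D - (k + 1) * e) * h (k + 1)| + |2 * (k + 1) * (n - k) * h k| := abs_sub _ _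
          _ = |(D - (k + 1) * e)| * |h (k + 1)| + 2 * (k + 1) * |n - k| * |h k| := by
              rw [abs_mul, abs_mul, abs_mul, abs_of_nonneg (by positivity : (0:ℝ) ≤ 2 * (k + 1))]
          _ ≤ ((1 + (k + 1) * |e|) * T) * (C1 * T ^ (k + 1))
              + 2 * (k + 1) * ((1 + k) * T ^ 2) * (C0 * T ^ k) := by gcongr
          _ = _ := by ring
      rw [div_mul_eq_mul_div, le_div_iff₀ hw]; linarith
    · have e1 : w * (T * |h (k + 2) - g (k + 2)|) ≤ (C1 * (1 + (k + 1) * |e|) + 2 * (k + 1) * (1 + k) * C0) * T ^ (k + 2) := by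
        have : w * (T * |h (k + 2) - g (k + 2)|) = T * |w * h (k + 2) - w * g (k + 2)| := by
          rw [← mul_sub, abs_mul, abs_of_pos hw]; ring
        rw [this, hh k, gg k]
        have e3 : (D - (k + 1) * e) * h (k + 1) - 2 * (k + 1) * (n - k) * h k
            - (D * g (k + 1) - 2 * (k + 1) * n * g k)
            = D * (h (k + 1) - g (k + 1)) - (k + 1) * e * h (k + 1)
              - 2 * (k + 1) * n * (h k - g k) + 2 * (k + 1) * k * h k := by ring
        rw [e3]
        have hk1 : (0:ℝ) ≤ k + 1 := by positivity
        have hk0 : (0:ℝ) ≤ k := by positivity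
        have t1 : |D * (h (k + 1) - g (k + 1)) - (k + 1) * e * h (k + 1)
              - 2 * (k + 1) * n * (h k - g k) + 2 * (k + 1) * k * h k|
            ≤ |D| * |h (k + 1) - g (k + 1)| + (k + 1) * |e| * |h (k + 1)|
              + 2 * (k + 1) * n * |h k - g k| + 2 * (k + 1) * k * |h k| := by
          refine (abs_add_le _ _).trans (add_le_add ((abs_sub _ _).trans (add_le_add
            ((abs_sub _ _).trans (add_le_add ?_ ?_)) ?_)) ?_)
          · rw [abs_mul]
          · rw [abs_mul, abs_mul, abs_of_nonneg hk1]
          · rw [abs_mul, abs_of_nonneg (by positivity : 0 ≤ 2 * ((k:ℝ) + 1) * n)]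
          · rw [abs_mul, abs_of_nonneg (by positivity : 0 ≤ 2 * ((k:ℝ) + 1) * k)]
        have hTT : T * T ^ (k + 1) ≤ T ^ (k + 2) := by rw [pow_succ' T (k + 1)]
        have hkT : T ^ (k + 1) ≤ T ^ (k + 2) := pow_le_pow_right₀ hT1 (by omega)
        calc T * |D * (h (k + 1) - g (k + 1)) - (k + 1) * e * h (k + 1)
              - 2 * (k + 1) * n * (h k - g k) + 2 * (k + 1) * k * h k|
            ≤ T * (|D| * |h (k + 1) - g (k + 1)| + (k + 1) * |e| * |h (k + 1)|
              + 2 * (k + 1) * n * |h k - g k| + 2 * (k + 1) * k * |h k|) := by gcongr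
          _ = |D| * (T * |h (k + 1) - g (k + 1)|) + T * ((k + 1) * |e| * |h (k + 1)|)
              + 2 * (k + 1) * n * (T * |h k - g k|) + T * (2 * (k + 1) * k * |h k|) := by ring
          _ ≤ T * (C1 * T ^ (k + 1)) + T * ((k + 1) * |e| * (C1 * T ^ (k + 1)))
              + 2 * (k + 1) * T ^ 2 * (C0 * T ^ k) + T * (2 * (k + 1) * k * (C0 * T ^ k)) := by
              gcongr
          _ = (C1 * (1 + (k + 1) * |e|) + 2 * (k + 1) * C0) * T ^ (k + 2)
              + (2 * (k + 1) * k * C0) * T ^ (k + 1) := by ring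
          _ ≤ (C1 * (1 + (k + 1) * |e|) + 2 * (k + 1) * C0) * T ^ (k + 2)
              + (2 * (k + 1) * k * C0) * T ^ (k + 2) := by gcongr
          _ = _ := by ring
      rw [div_mul_eq_mul_div, le_div_iff₀ hw]; linarith

lemma qPoly_derivative (k : ℕ) :
    Polynomial.derivative (qPoly (k + 1)) = ((k : Polynomial ℝ) + 1) * qPoly k := by
  induction k with
  | zero => simp [qPoly]
  | succ k ih =>
    have hk : Polynomial.X * qPoly k - Polynomial.derivative (qPoly k) = qPoly (k + 1) := by
      rcases k with _ | k <;> simp [qPoly]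
    simp only [qPoly, Polynomial.derivative_sub, Polynomial.derivative_mul,
      Polynomial.derivative_X, ih, Polynomial.derivative_add, Polynomial.derivative_natCast,
      Polynomial.derivative_one]
    push_cast
    linear_combination ((k : Polynomial ℝ) + 1) * hk

lemma qPoly_succ_succ (k : ℕ) :
    qPoly (k + 2) = Polynomial.X * qPoly (k + 1) - ((k : Polynomial ℝ) + 1) * qPoly k := by
  rw [← qPoly_derivative, qPoly]

lemma qPoly_monic_natDegree (k : ℕ) : (qPoly k).Monic ∧ (qPoly k).natDegree = k := by
  induction k using Nat.twoStepInduction with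
  | zero => simp [qPoly]
  | one => simp [qPoly, Polynomial.monic_X]
  | more k ih0 ih1 =>
    have hm : (Polynomial.X * qPoly (k + 1)).Monic := Polynomial.monic_X.mul ih1.1
    have hd : (Polynomial.X * qPoly (k + 1)).natDegree = k + 2 := by
      rw [Polynomial.monic_X.natDegree_mul ih1.1, ih1.2]; simp; ring
    have hlt : (Polynomial.derivative (qPoly (k + 1))).degree
        < (Polynomial.X * qPoly (k + 1)).degree := by
      apply Polynomial.degree_lt_degree
      rw [hd]
      have := Polynomial.natDegree_derivative_le (qPoly (k + 1))
      omega
    refine ⟨hm.sub_of_left hlt, ?_⟩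
    rw [qPoly, Polynomial.natDegree_sub_eq_left_of_natDegree_lt, hd]
    rw [hd]
    have := Polynomial.natDegree_derivative_le (qPoly (k + 1))
    omega

lemma qPoly_eval_eq_prod {k : ℕ} {t : Fin k → ℝ} (ht : Function.Injective t)
    (hroots : ∀ i, (qPoly k).eval (t i) = 0) (s : ℝ) :
    (qPoly k).eval s = ∏ i, (s - t i) := by
  have hdvd : (∏ i, (Polynomial.X - Polynomial.C (t i))) ∣ qPoly k :=
    Finset.prod_dvd_of_coprime
      (fun i _ j _ hij => Polynomial.pairwise_coprime_X_sub_C ht hij)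
      (fun i _ => Polynomial.dvd_iff_isRoot.2 (hroots i))
  have := Polynomial.eq_of_monic_of_dvd_of_natDegree_le
    (Polynomial.monic_prod_of_monic _ _ fun i _ => Polynomial.monic_X_sub_C (t i))
    (qPoly_monic_natDegree k).1 hdvd (by
      rw [(qPoly_monic_natDegree k).2, Polynomial.natDegree_prod_of_monic _ _
        fun i _ => Polynomial.monic_X_sub_C (t i)]; simp)
  rw [this, Polynomial.eval_prod]
  simp

lemma cylPoly_recurrence {a : ℝ} (ha : 0 < a) (ha' : a < 1 / 2) {n l : ℕ} (hl : l ≤ n)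
    {h : ℕ → ℝ} (hdef : ∀ j, h j = (Polynomial.derivative^[j] (cylPoly n l)).eval a
      / (cylPoly n l).eval a) :
    h 0 = 1 ∧ a * (1 - 2 * a) * h 1 = (1 - 2 * a) * n - l ∧
    ∀ j : ℕ, a * (1 - 2 * a) * h (j + 2) =
      ((1 - 2 * a) * n - l - (j + 1) * (1 - 4 * a)) * h (j + 1)
        - 2 * (j + 1) * (n - j) * h j := by
  have hpos := eval_cylPoly_pos n l ha ha'
  have key : ∀ j, (Polynomial.derivative^[j] (cylPoly n l)).eval a
      = h j * (cylPoly n l).eval a := fun j => by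
    rw [hdef]; field_simp
  refine ⟨?_, ?_, fun j => ?_⟩
  · rw [hdef]; simp [hpos.ne']
  · have := congrArg (Polynomial.eval a) (cylPoly_derivative n l hl)
    have k1 := key 1
    simp only [Function.iterate_one] at k1
    simp only [Polynomial.eval_mul, Polynomial.eval_sub, Polynomial.eval_X, Polynomial.eval_one,
      Polynomial.eval_ofNat, Polynomial.eval_natCast, k1] at this
    apply mul_right_cancel₀ hpos.ne'
    linear_combination this
  · have := congrArg (Polynomial.eval a) (cylPoly_iterate_derivative n l hl j)
    simp only [Polynomial.eval_mul, Polynomial.eval_sub, Polynomial.eval_X, Polynomial.eval_one,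
      Polynomial.eval_ofNat, Polynomial.eval_natCast, Polynomial.eval_add, key] at this
    apply mul_right_cancel₀ hpos.ne'
    linear_combination this

lemma hermite_recurrence {w n : ℝ} (hw : 0 < w) (hn : 1 ≤ n) (D : ℝ) {g : ℕ → ℝ}
    (hdef : ∀ j, g j = √(2 * n / w) ^ j * (qPoly j).eval (D / (w * √(2 * n / w)))) :
    g 0 = 1 ∧ w * g 1 = D ∧
    ∀ j : ℕ, w * g (j + 2) = D * g (j + 1) - 2 * (j + 1) * n * g j := by
  have hθ : 0 < √(2 * n / w) := Real.sqrt_pos.2 (by positivity)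
  have hsq : w * √(2 * n / w) ^ 2 = 2 * n := by
    rw [Real.sq_sqrt (by positivity)]; field_simp
  set θ := √(2 * n / w)
  have hτ : w * θ * (D / (w * θ)) = D := by field_simp
  refine ⟨by simp [hdef, qPoly], ?_, fun j => ?_⟩
  · rw [hdef]; simp only [qPoly, Polynomial.eval_X]; linear_combination hτ
  · simp only [hdef, qPoly_succ_succ, Polynomial.eval_sub, Polynomial.eval_mul,
      Polynomial.eval_X, Polynomial.eval_add, Polynomial.eval_one, Polynomial.eval_natCast]
    set A := (qPoly (j + 1)).eval (D / (w * θ))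
    set B := (qPoly j).eval (D / (w * θ))
    linear_combination θ ^ (j + 1) * A * hτ - (j + 1) * θ ^ j * B * hsq

lemma exists_bound_cylPoly {a : ℝ} (ha : 0 < a) (ha' : a < 1 / 2) (k : ℕ) :
    ∃ C : ℝ, 0 < C ∧ ∀ n l : ℕ, 1 ≤ n → l ≤ n → ∀ g : ℕ → ℝ,
      (∀ j, g j = √(2 * n / (a * (1 - 2 * a))) ^ j * (qPoly j).eval
        (((1 - 2 * a) * n - l) / (a * (1 - 2 * a) * √(2 * n / (a * (1 - 2 * a)))))) →
      |(Polynomial.derivative^[k] (cylPoly n l)).eval a|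
        ≤ C * (√n + |(1 - 2 * a) * n - l|) ^ k * (cylPoly n l).eval a ∧
      (√n + |(1 - 2 * a) * n - l|) * |(Polynomial.derivative^[k] (cylPoly n l)).eval a
        - g k * (cylPoly n l).eval a|
        ≤ C * (√n + |(1 - 2 * a) * n - l|) ^ k * (cylPoly n l).eval a := by
  have hw : 0 < a * (1 - 2 * a) := mul_pos ha (by linarith)
  obtain ⟨C, hC, H⟩ := abs_three_term_bound (a * (1 - 2 * a)) (1 - 4 * a) hw k
  refine ⟨C, hC, fun n l hn hl g hg => ?_⟩
  have hpos := eval_cylPoly_pos n l ha ha'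
  have hn' : (1:ℝ) ≤ n := by exact_mod_cast hn
  obtain ⟨h0, h1, hh⟩ := cylPoly_recurrence ha ha' hl (fun j => rfl)
  obtain ⟨g0, g1, gg⟩ := hermite_recurrence hw hn' ((1 - 2 * a) * n - l) hg
  obtain ⟨A, B⟩ := H n ((1 - 2 * a) * n - l) (fun j => (Polynomial.derivative^[j]
    (cylPoly n l)).eval a / (cylPoly n l).eval a) g hn' h0 g0 h1 g1 hh gg
  set P := (cylPoly n l).eval a
  set Q := (Polynomial.derivative^[k] (cylPoly n l)).eval a
  have e : Q = Q / P * P := by field_simp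
  constructor
  · rw [e, abs_mul, abs_of_pos hpos]; gcongr
  · rw [e, ← sub_mul, abs_mul, abs_of_pos hpos, ← mul_assoc]; gcongr

lemma abs_iterate_derivative_cylPoly_le {a : ℝ} (ha : 0 < a) (ha' : a < 1 / 2) (k : ℕ) :
    ∃ C : ℝ, 0 < C ∧ ∀ n l : ℕ, 1 ≤ n → l ≤ n →
      |(Polynomial.derivative^[k] (cylPoly n l)).eval a|
        ≤ C * (√n + |(1 - 2 * a) * n - l|) ^ k * (cylPoly n l).eval a := by
  obtain ⟨C, hC, H⟩ := exists_bound_cylPoly ha ha' k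
  exact ⟨C, hC, fun n l hn hl => (H n l hn hl _ fun j => rfl).1⟩

lemma le_iterate_derivative_cylPoly {a : ℝ} (ha : 0 < a) (ha' : a < 1 / 2) {k : ℕ}
    {t : Fin k → ℝ} (ht : Function.Injective t) (hroots : ∀ i, (qPoly k).eval (t i) = 0)
    {η : ℝ} (hη : 0 < η) :
    ∃ c : ℝ, 0 < c ∧ ∃ N : ℕ, ∀ n l : ℕ, N ≤ n → l ≤ n →
      (∀ i, η * √n ≤ |(1 - 2 * a) * n - l - t i * √(2 * a * (1 - 2 * a)) * √n|) →
      ∀ σ : ℝ, |σ| = 1 →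
        0 < σ * ∏ i, ((1 - 2 * a) * n - l - t i * √(2 * a * (1 - 2 * a)) * √n) →
        c * (√n + |(1 - 2 * a) * n - l|) ^ k * (cylPoly n l).eval a
          ≤ σ * (Polynomial.derivative^[k] (cylPoly n l)).eval a := by
  have hw : 0 < a * (1 - 2 * a) := mul_pos ha (by linarith)
  obtain ⟨C, hC, H⟩ := exists_bound_cylPoly ha ha' k
  set w := a * (1 - 2 * a) with hwdef
  set τ : Fin k → ℝ := fun i => t i * √(2 * a * (1 - 2 * a)) with hτ
  set κ : Fin k → ℝ := fun i => w * ((1 + |τ i|) / η + 1) with hκ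
  have hκpos : ∀ i, 0 < κ i := fun i => by positivity
  set K := ∏ i, κ i with hK
  have hKpos : 0 < K := Finset.prod_pos fun i _ => hκpos i
  obtain ⟨N, hN⟩ := exists_nat_ge ((2 * K * C) ^ 2)
  refine ⟨1 / (2 * K), by positivity, max N 1, fun n l hn hl hsep σ hσ hprod => ?_⟩
  have hn1 : 1 ≤ n := (le_max_right _ _).trans hn
  have hn' : (1:ℝ) ≤ n := by exact_mod_cast hn1
  have hnN : (N:ℝ) ≤ n := by exact_mod_cast (le_max_left _ _).trans hn
  have hpos := eval_cylPoly_pos n l ha ha'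
  obtain ⟨-, B⟩ := H n l hn1 hl _ fun j => rfl
  set θ := √(2 * n / w) with hθdef
  have hθ : 0 < θ := Real.sqrt_pos.2 (by positivity)
  have hs : 0 < √(n:ℝ) := Real.sqrt_pos.2 (by linarith)
  have hθw : w * θ = √(2 * a * (1 - 2 * a)) * √n := by
    have h2w : 2 * a * (1 - 2 * a) = 2 * w := by rw [hwdef]; ring
    rw [h2w, ← Real.sqrt_mul (by positivity), hθdef]
    have : 2 * w * n = w ^ 2 * (2 * n / w) := by field_simp
    rw [this, Real.sqrt_mul (by positivity), Real.sqrt_sq hw.le]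
  set D := (1 - 2 * a) * n - l with hD
  set T := √n + |D| with hT
  have hTpos : 0 < T := by positivity
  have hg : θ ^ k * (qPoly k).eval (D / (w * θ)) = ∏ i, ((D - τ i * √n) / w) := by
    rw [qPoly_eval_eq_prod ht hroots, ← Fin.prod_const, ← Finset.prod_mul_distrib]
    refine Finset.prod_congr rfl fun i _ => ?_
    have : τ i * √n = t i * (w * θ) := by rw [hθw, hτ]; ring
    rw [this]; field_simp
  rw [hg] at B
  set g := ∏ i, ((D - τ i * √n) / w) with hgdef
  set P := (cylPoly n l).eval a
  set Q := (Polynomial.derivative^[k] (cylPoly n l)).eval a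
  have hgeq : g = (∏ i, (D - τ i * √n)) / w ^ k := by
    rw [hgdef, Finset.prod_div_distrib, Fin.prod_const]
  have hσg : |g| = σ * g := by
    have h1 : 0 < σ * g := by
      rw [hgeq, ← mul_div_assoc]; exact div_pos hprod (by positivity)
    rw [← abs_of_pos h1, abs_mul, hσ, one_mul]
  have hTle : T ^ k ≤ K * |g| := by
    rw [hgdef, Finset.abs_prod, hK, ← Finset.prod_mul_distrib, ← Fin.prod_const]
    refine Finset.prod_le_prod (fun i _ => hTpos.le) fun i _ => ?_
    have h1 := hsep i
    change η * √n ≤ |D - τ i * √n| at h1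
    rw [abs_div, abs_of_pos hw, hκ]
    have e1 : w * ((1 + |τ i|) / η + 1) * (|D - τ i * √n| / w)
        = (1 + |τ i|) * (|D - τ i * √n| / η) + |D - τ i * √n| := by
      field_simp
    have h2 : √n ≤ |D - τ i * √n| / η := by rw [le_div_iff₀ hη]; linarith
    have h3 : |D| ≤ |D - τ i * √n| + |τ i| * √n := by
      have := abs_add_le (D - τ i * √n) (τ i * √n)
      rw [abs_mul, abs_of_pos hs] at this
      simpa using this
    simp only
    rw [e1]
    have h4 : (1 + |τ i|) * √n ≤ (1 + |τ i|) * (|D - τ i * √n| / η) := by gcongr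
    linarith
  have hsT : 2 * K * C ≤ T := by
    have : 2 * K * C ≤ √n := Real.le_sqrt_of_sq_le (hN.trans hnN)
    have := abs_nonneg D
    linarith
  have hB : |Q - g * P| ≤ T ^ k / (2 * K) * P := by
    have h1 : T * |Q - g * P| ≤ T * (T ^ k / (2 * K) * P) := by
      refine B.trans ?_
      have : C ≤ T / (2 * K) := by rw [le_div_iff₀ (by positivity)]; linarith
      calc C * T ^ k * P ≤ T / (2 * K) * T ^ k * P := by gcongr
        _ = _ := by ring
    exact le_of_mul_le_mul_left h1 hTpos
  have hfin : σ * Q = σ * g * P + σ * (Q - g * P) := by ring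
  have hlow : -|Q - g * P| ≤ σ * (Q - g * P) := by
    have := neg_abs_le (σ * (Q - g * P))
    rwa [abs_mul, hσ, one_mul] at this
  have hgT : T ^ k / K * P ≤ σ * g * P := by
    rw [← hσg]
    have : T ^ k / K ≤ |g| := by rw [div_le_iff₀ hKpos]; linarith
    gcongr
  have : 1 / (2 * K) * T ^ k * P = T ^ k / K * P - T ^ k / (2 * K) * P := by
    field_simp; ring
  linarith

lemma iteratedDeriv_real_of_complex {f : ℂ → ℂ} {U : Set ℂ} (hU : IsOpen U)
    (hf : DifferentiableOn ℂ f U) {g : ℝ → ℝ} (hg : ∀ b : ℝ, g b = (f b).re) (j : ℕ) :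
    DifferentiableOn ℂ (iteratedDeriv j f) U ∧
      ∀ b : ℝ, (b : ℂ) ∈ U → iteratedDeriv j g b = (iteratedDeriv j f b).re := by
  induction j with
  | zero => exact ⟨by simpa using hf, fun b _ => by simp [hg]⟩
  | succ j ih =>
    obtain ⟨h1, h2⟩ := ih
    refine ⟨by rw [iteratedDeriv_succ]; exact h1.deriv hU, fun b hb => ?_⟩
    rw [iteratedDeriv_succ, iteratedDeriv_succ]
    have hev : iteratedDeriv j g =ᶠ[𝓝 b] fun b : ℝ => (iteratedDeriv j f b).re := by
      have : ∀ᶠ c : ℝ in 𝓝 b, (c : ℂ) ∈ U :=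
        Complex.continuous_ofReal.continuousAt.eventually (hU.mem_nhds hb)
      filter_upwards [this] with c hc using h2 c hc
    rw [hev.deriv_eq]
    exact ((h1.differentiableAt (hU.mem_nhds hb)).hasDerivAt.real_of_complex).deriv

lemma lCount_le (x : ℝ) (n : ℕ) : lCount x n ≤ n := by
  simpa [lCount] using Finset.card_filter_le (Finset.range n) (fun i => tDigit x i = 1)

/-- The complexification in the parameter of Okamoto's function. -/
noncomputable def okamotoC (z : ℂ) (x : ℝ) : ℂ :=
  ∑' n : ℕ, z ^ (n - lCount x n) * (1 - 2 * z) ^ lCount x n *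
    (if tDigit x n = 0 then 0 else if tDigit x n = 1 then z else 1 - z)

lemma okamoto_eq_re (b x : ℝ) : Okamoto b x = (okamotoC b x).re := by
  have : okamotoC b x = (Okamoto b x : ℂ) := by
    rw [okamotoC, Okamoto, Complex.ofReal_tsum]
    congr 1
    funext n
    rw [qDig]
    split_ifs <;> simp
  rw [this, Complex.ofReal_re]

lemma norm_okamotoC_term_le {z : ℂ} {ρ : ℝ} (h1 : ‖z‖ ≤ ρ) (h2 : ‖1 - 2 * z‖ ≤ ρ) (hρ : ρ ≤ 1)
    (x : ℝ) (n : ℕ) :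
    ‖z ^ (n - lCount x n) * (1 - 2 * z) ^ lCount x n *
      (if tDigit x n = 0 then 0 else if tDigit x n = 1 then z else 1 - z)‖ ≤ ρ ^ n * 2 := by
  have hρ0 : 0 ≤ ρ := (norm_nonneg _).trans h1
  have hq : ‖(if tDigit x n = 0 then 0 else if tDigit x n = 1 then z else 1 - z)‖ ≤ 2 := by
    split_ifs
    · simp
    · linarith
    · have := norm_sub_le 1 z
      rw [norm_one] at this
      linarith
  rw [norm_mul, norm_mul, norm_pow, norm_pow]
  calc ‖z‖ ^ (n - lCount x n) * ‖1 - 2 * z‖ ^ lCount x n * _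
      ≤ ρ ^ (n - lCount x n) * ρ ^ lCount x n * 2 := by gcongr
    _ = ρ ^ n * 2 := by rw [← pow_add, Nat.sub_add_cancel (lCount_le x n)]

lemma summable_okamoto {b : ℝ} (hb : 0 < b) (hb' : b < 1 / 2) (x : ℝ) :
    Summable fun n : ℕ =>
      b ^ (n - lCount x n) * (1 - 2 * b) ^ lCount x n * qDig b (tDigit x n) := by
  set ρ := max b (1 - 2 * b)
  have hρ : ρ < 1 := max_lt (by linarith) (by linarith)
  have hρ0 : 0 ≤ ρ := hb.le.trans (le_max_left _ _)
  refine Summable.of_norm_bounded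
    ((summable_geometric_of_lt_one hρ0 hρ).mul_right 2) fun n => ?_
  have hz1 : ‖(b : ℂ)‖ ≤ ρ := by
    rw [Complex.norm_real, Real.norm_of_nonneg hb.le]; exact le_max_left _ _
  have hz2 : ‖1 - 2 * (b : ℂ)‖ ≤ ρ := by
    have : (1 - 2 * (b : ℂ)) = ((1 - 2 * b : ℝ) : ℂ) := by push_cast; ring
    rw [this, Complex.norm_real, Real.norm_of_nonneg (by linarith)]; exact le_max_right _ _
  convert norm_okamotoC_term_le hz1 hz2 hρ.le x n using 1
  rw [← Complex.norm_real, qDig]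
  congr 1
  split_ifs <;> simp

lemma okamoto_contDiffAt_and_bound {a : ℝ} (ha : 0 < a) (ha' : a < 1 / 2) (j : ℕ) :
    (∀ x, ContDiffAt ℝ j (fun b => Okamoto b x) a) ∧
    ∃ B : ℝ, 0 < B ∧ ∀ x, |iteratedDeriv j (fun b => Okamoto b x) a| ≤ B := by
  set ρ₀ := max a (1 - 2 * a) with hρ₀
  have h0 : ρ₀ < 1 := max_lt (by linarith) (by linarith)
  have h00 : 0 < ρ₀ := ha.trans_le (le_max_left _ _)
  set r := (1 - ρ₀) / 8 with hr
  have hrpos : 0 < r := by rw [hr]; linarith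
  set ρ := ρ₀ + 4 * r with hρ
  have hρ1 : ρ < 1 := by rw [hρ, hr]; linarith
  have hρ0 : 0 ≤ ρ := by positivity
  set U := Metric.ball (a : ℂ) (2 * r)
  have hz : ∀ z ∈ U, ‖z‖ ≤ ρ ∧ ‖1 - 2 * z‖ ≤ ρ := by
    intro z hz
    have hd : ‖z - a‖ < 2 * r := by simpa [U, dist_eq_norm] using hz
    constructor
    · have e : z = a + (z - a) := by ring
      have := norm_add_le (a : ℂ) (z - a)
      rw [← e, Complex.norm_real, Real.norm_of_nonneg ha.le] at this
      have := le_max_left a (1 - 2 * a)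
      linarith
    · have e : 1 - 2 * z = ((1 - 2 * a : ℝ) : ℂ) - 2 * (z - a) := by push_cast; ring
      have := norm_sub_le ((1 - 2 * a : ℝ) : ℂ) (2 * (z - a))
      rw [← e, Complex.norm_real, Real.norm_of_nonneg (by linarith), norm_mul,
        Complex.norm_ofNat] at this
      have := le_max_right a (1 - 2 * a)
      linarith
  have hsum : Summable fun n : ℕ => ρ ^ n * 2 :=
    (summable_geometric_of_lt_one hρ0 hρ1).mul_right 2
  have hdiff : ∀ x, DifferentiableOn ℂ (fun z => okamotoC z x) U := fun x => by
    refine Complex.differentiableOn_tsum_of_summable_norm hsum (fun n => ?_) Metric.isOpen_ball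
      fun n z hzU => norm_okamotoC_term_le (hz z hzU).1 (hz z hzU).2 hρ1.le x n
    split_ifs <;> fun_prop
  have hbd : ∀ x, ∀ z ∈ U, ‖okamotoC z x‖ ≤ ∑' n, ρ ^ n * 2 := fun x z hzU =>
    tsum_of_norm_bounded hsum.hasSum
      fun n => norm_okamotoC_term_le (hz z hzU).1 (hz z hzU).2 hρ1.le x n
  have haU : (a : ℂ) ∈ U := Metric.mem_ball_self (by positivity)
  have hsub : Metric.closedBall (a : ℂ) r ⊆ U := Metric.closedBall_subset_ball (by linarith)
  refine ⟨fun x => ?_, j.factorial * (∑' n, ρ ^ n * 2) / r ^ j + 1, ?_, fun x => ?_⟩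
  · have : (fun b => Okamoto b x) = fun b : ℝ => (okamotoC b x).re :=
      funext fun b => okamoto_eq_re b x
    rw [this]
    exact ((hdiff x).analyticAt (Metric.isOpen_ball.mem_nhds haU)).contDiffAt.real_of_complex
  · have : 0 ≤ ∑' n, ρ ^ n * 2 := tsum_nonneg fun n => by positivity
    positivity
  · rw [(iteratedDeriv_real_of_complex Metric.isOpen_ball (hdiff x)
      (fun b => okamoto_eq_re b x) j).2 a haU]
    refine (Complex.abs_re_le_norm _).trans (le_trans ?_ (le_add_of_nonneg_right zero_le_one))
    exact Complex.norm_iteratedDeriv_le_of_forall_mem_sphere_norm_le j hrpos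
      ((hdiff x).diffContOnCl_ball hsub)
      fun z hzs => hbd x z (hsub (Metric.sphere_subset_closedBall hzs))

lemma tDigit_spec {x : ℝ} (hx1 : x < 1) (n : ℕ) :
    (tDigit x n : ℤ) = ⌊(3:ℝ) ^ (n + 1) * x⌋ - 3 * ⌊(3:ℝ) ^ n * x⌋ ∧ tDigit x n ≤ 2 := by
  have h1 : (3:ℝ) ^ (n + 1) * x = 3 * (3 ^ n * x) := by ring
  have h2 := Int.floor_le ((3:ℝ) ^ n * x)
  have h3 := Int.lt_floor_add_one ((3:ℝ) ^ n * x)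
  have h4 : 3 * ⌊(3:ℝ) ^ n * x⌋ ≤ ⌊(3:ℝ) ^ (n + 1) * x⌋ := by
    rw [Int.le_floor, h1]; push_cast; linarith
  have h5 : ⌊(3:ℝ) ^ (n + 1) * x⌋ < 3 * ⌊(3:ℝ) ^ n * x⌋ + 3 := by
    rw [Int.floor_lt, h1]; push_cast; linarith
  rw [tDigit, if_neg hx1.ne]
  omega

lemma floor_mul_sub {x : ℝ} (p n : ℕ) :
    ⌊(3:ℝ) ^ n * Int.fract ((3:ℝ) ^ p * x)⌋
      = ⌊(3:ℝ) ^ (n + p) * x⌋ - 3 ^ n * ⌊(3:ℝ) ^ p * x⌋ := by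
  have : (3:ℝ) ^ n * Int.fract ((3:ℝ) ^ p * x)
      = (3:ℝ) ^ (n + p) * x - ((3 ^ n * ⌊(3:ℝ) ^ p * x⌋ : ℤ) : ℝ) := by
    rw [Int.fract]; push_cast; ring
  rw [this, Int.floor_sub_intCast]

lemma tDigit_fract {x : ℝ} (hx1 : x < 1) (p n : ℕ) :
    tDigit (Int.fract ((3:ℝ) ^ p * x)) n = tDigit x (n + p) := by
  have h1 := (tDigit_spec (Int.fract_lt_one ((3:ℝ) ^ p * x)) n).1
  have h2 := (tDigit_spec hx1 (n + p)).1
  rw [floor_mul_sub, floor_mul_sub] at h1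
  have e : n + 1 + p = n + p + 1 := by ring
  rw [e, pow_succ] at h1
  have : (tDigit (Int.fract ((3:ℝ) ^ p * x)) n : ℤ) = tDigit x (n + p) := by
    rw [h1, h2]; ring
  exact_mod_cast this

lemma lCount_succ (x : ℝ) (n : ℕ) :
    lCount x (n + 1) = lCount x n + if tDigit x n = 1 then 1 else 0 := by
  rw [lCount, lCount, Finset.range_add_one, Finset.filter_insert]
  split_ifs
  · rw [Finset.card_insert_of_notMem (by simp)]
  · rfl

lemma lCount_add {x : ℝ} (hx1 : x < 1) (p n : ℕ) :
    lCount x (n + p) = lCount x p + lCount (Int.fract ((3:ℝ) ^ p * x)) n := by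
  induction n with
  | zero => simp [lCount]
  | succ n ih =>
    rw [show n + 1 + p = n + p + 1 by ring, lCount_succ, lCount_succ, tDigit_fract hx1, ih]
    ring

/-- The value of `F_b` at the left end of the triadic interval of level `p` containing `x`. -/
noncomputable def okamotoPartial (b x : ℝ) (p : ℕ) : ℝ :=
  ∑ n ∈ Finset.range p, (cylPoly n (lCount x n)).eval b * qDig b (tDigit x n)

lemma okamoto_split {b : ℝ} (hb : 0 < b) (hb' : b < 1 / 2) {x : ℝ} (hx1 : x < 1) (p : ℕ) :
    Okamoto b x = okamotoPartial b x p
      + (cylPoly p (lCount x p)).eval b * Okamoto b (Int.fract ((3:ℝ) ^ p * x)) := by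
  rw [Okamoto, ← (summable_okamoto hb hb' x).sum_add_tsum_nat_add p, Okamoto, ← tsum_mul_left,
    okamotoPartial]
  congr 1
  · exact Finset.sum_congr rfl fun n _ => by rw [eval_cylPoly]
  · congr 1
    funext n
    have h1 := lCount_le x p
    have h2 := lCount_le (Int.fract ((3:ℝ) ^ p * x)) n
    rw [eval_cylPoly, tDigit_fract hx1, lCount_add hx1,
      show n + p - (lCount x p + lCount (Int.fract ((3:ℝ) ^ p * x)) n)
        = (p - lCount x p) + (n - lCount (Int.fract ((3:ℝ) ^ p * x)) n) by omega,
      pow_add, pow_add]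
    ring

lemma cylPoly_succ (b x : ℝ) (n : ℕ) :
    (cylPoly (n + 1) (lCount x (n + 1))).eval b = (cylPoly n (lCount x n)).eval b *
      if tDigit x n = 1 then 1 - 2 * b else b := by
  have h := lCount_le x n
  rw [eval_cylPoly, eval_cylPoly, lCount_succ]
  split_ifs
  · rw [show n + 1 - (lCount x n + 1) = n - lCount x n by omega]; ring
  · rw [show n + 1 - (lCount x n + 0) = n - lCount x n + 1 by omega]; ring

lemma okamotoPartial_succ (b x : ℝ) (n : ℕ) :
    okamotoPartial b x (n + 1) = okamotoPartial b x n
      + (cylPoly n (lCount x n)).eval b * qDig b (tDigit x n) := by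
  rw [okamotoPartial, Finset.sum_range_succ, okamotoPartial]

lemma same_interval {x y : ℝ} (hx1 : x < 1) (hy1 : y < 1) (p : ℕ)
    (h : ⌊(3:ℝ) ^ p * y⌋ = ⌊(3:ℝ) ^ p * x⌋) (b : ℝ) :
    lCount y p = lCount x p ∧ okamotoPartial b y p = okamotoPartial b x p := by
  induction p with
  | zero => simp [lCount, okamotoPartial]
  | succ p ih =>
    obtain ⟨h1, h2⟩ := tDigit_spec hx1 p
    obtain ⟨h3, h4⟩ := tDigit_spec hy1 p
    obtain ⟨i1, i2⟩ := ih (by omega)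
    have hd : tDigit y p = tDigit x p := by omega
    rw [lCount_succ, lCount_succ, okamotoPartial_succ, okamotoPartial_succ, i1, i2, hd]
    exact ⟨rfl, rfl⟩

lemma adjacent_interval {x y : ℝ} (hx1 : x < 1) (hy1 : y < 1) (hx : 0 ≤ x) (hy : 0 ≤ y) (p : ℕ)
    (h : ⌊(3:ℝ) ^ p * y⌋ = ⌊(3:ℝ) ^ p * x⌋ + 1) (b : ℝ) :
    lCount y p ≤ lCount x p + 1 ∧ lCount x p ≤ lCount y p + 1 ∧
      okamotoPartial b y p = okamotoPartial b x p + (cylPoly p (lCount x p)).eval b := by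
  induction p with
  | zero =>
    have e1 : ⌊x⌋ = 0 := Int.floor_eq_zero_iff.2 ⟨hx, hx1⟩
    have e2 : ⌊y⌋ = 0 := Int.floor_eq_zero_iff.2 ⟨hy, hy1⟩
    simp [e1, e2] at h
  | succ p ih =>
    obtain ⟨h1, h2⟩ := tDigit_spec hx1 p
    obtain ⟨h3, h4⟩ := tDigit_spec hy1 p
    rw [cylPoly_succ, lCount_succ, lCount_succ, okamotoPartial_succ, okamotoPartial_succ]
    by_cases hs : ⌊(3:ℝ) ^ p * y⌋ = ⌊(3:ℝ) ^ p * x⌋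
    · obtain ⟨i1, i2⟩ := same_interval hx1 hy1 p hs b
      rw [i1, i2]
      have hd : tDigit x p = 0 ∧ tDigit y p = 1 ∨ tDigit x p = 1 ∧ tDigit y p = 2 := by omega
      rcases hd with ⟨d1, d2⟩ | ⟨d1, d2⟩ <;> rw [d1, d2] <;>
        refine ⟨by split_ifs <;> omega, by split_ifs <;> omega, ?_⟩
      · simp [qDig]
      · simp [qDig]
        ring
    · have hd : tDigit x p = 2 ∧ tDigit y p = 0 := by omega
      obtain ⟨i1, i2, i3⟩ := ih (by omega)
      rw [i3, hd.1, hd.2]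
      refine ⟨by simpa using i1, by simpa using i2, ?_⟩
      simp [qDig]
      ring

lemma okamoto_nonneg {b : ℝ} (hb : 0 < b) (hb' : b < 1 / 2) (x : ℝ) : 0 ≤ Okamoto b x := by
  refine tsum_nonneg fun n => ?_
  have h1 : 0 < 1 - 2 * b := by linarith
  have h2 : 0 ≤ qDig b (tDigit x n) := by rw [qDig]; split_ifs <;> linarith
  positivity

lemma okamoto_le_one {b : ℝ} (hb : 0 < b) (hb' : b < 1 / 2) {x : ℝ} (hx1 : x < 1) :
    Okamoto b x ≤ 1 := by
  have h1 : 0 < 1 - 2 * b := by linarith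
  have key : ∀ n, okamotoPartial b x n + (cylPoly n (lCount x n)).eval b ≤ 1 := fun n => by
    induction n with
    | zero => simp [okamotoPartial, eval_cylPoly, lCount]
    | succ n ih =>
      have hp := eval_cylPoly_pos n (lCount x n) hb hb'
      rw [okamotoPartial_succ, cylPoly_succ, add_assoc, ← mul_add]
      have h2 := (tDigit_spec hx1 n).2
      have : qDig b (tDigit x n) + (if tDigit x n = 1 then 1 - 2 * b else b) ≤ 1 := by
        interval_cases tDigit x n <;> simp [qDig] <;> linarith
      nlinarith
  refine Real.tsum_le_of_sum_range_le (fun n => ?_) fun n => ?_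
  · have h2 : 0 ≤ qDig b (tDigit x n) := by rw [qDig]; split_ifs <;> linarith
    positivity
  · have h3 := key n
    have hp := eval_cylPoly_pos n (lCount x n) hb hb'
    simp only [okamotoPartial, eval_cylPoly] at h3 hp
    linarith

/-- Bounds on `F_b` in terms of the first ternary digit. -/
lemma okamoto_first_digit {b : ℝ} (hb : 0 < b) (hb' : b < 1 / 2) {x : ℝ} (hx1 : x < 1) :
    qDig b (tDigit x 0) ≤ Okamoto b x ∧
      Okamoto b x ≤ qDig b (tDigit x 0) + if tDigit x 0 = 1 then 1 - 2 * b else b := by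
  have h := okamoto_split hb hb' hx1 1
  have h0 := okamoto_nonneg hb hb' (Int.fract ((3:ℝ) ^ 1 * x))
  have h1 := okamoto_le_one hb hb' (Int.fract_lt_one ((3:ℝ) ^ 1 * x))
  have hc := cylPoly_succ b x 0
  have e : (cylPoly 0 (lCount x 0)).eval b = 1 := by simp [eval_cylPoly, lCount]
  rw [e, one_mul] at hc
  rw [zero_add] at hc
  have hs : okamotoPartial b x 1 = qDig b (tDigit x 0) := by
    simp [okamotoPartial, e]
  rw [hs, hc] at h
  have hr : 0 < if tDigit x 0 = 1 then 1 - 2 * b else b := by split_ifs <;> linarith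
  constructor <;> nlinarith

lemma okamoto_sub {b : ℝ} (hb : 0 < b) (hb' : b < 1 / 2) {u v : ℝ} (hu1 : u < 1) (hv1 : v < 1)
    (hu : 0 ≤ u) (hv : 0 ≤ v) (p : ℕ) {e : ℕ} (he : e ≤ 1)
    (h : ⌊(3:ℝ) ^ p * v⌋ = ⌊(3:ℝ) ^ p * u⌋ + e) :
    Okamoto b v - Okamoto b u = e * (cylPoly p (lCount u p)).eval b
      - (cylPoly p (lCount u p)).eval b * Okamoto b (Int.fract ((3:ℝ) ^ p * u))
      + (cylPoly p (lCount v p)).eval b * Okamoto b (Int.fract ((3:ℝ) ^ p * v)) := by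
  rw [okamoto_split hb hb' hu1 p, okamoto_split hb hb' hv1 p]
  interval_cases e
  · obtain ⟨h1, h2⟩ := same_interval hu1 hv1 p (by simpa using h) b
    rw [h2]; push_cast; ring
  · obtain ⟨-, -, h3⟩ := adjacent_interval hu1 hv1 hu hv p (by simpa using h) b
    rw [h3]; push_cast; ring

lemma okamoto_gap {b : ℝ} (hb : 0 < b) (hb' : b < 1 / 2) {u v : ℝ} (hu1 : u < 1) (hv1 : v < 1)
    (p : ℕ) {e : ℕ} (he : e ≤ 1)
    (h : ⌊(3:ℝ) ^ p * v⌋ = ⌊(3:ℝ) ^ p * u⌋ + e)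
    (h' : ⌊(3:ℝ) ^ (p + 1) * u⌋ + 2 ≤ ⌊(3:ℝ) ^ (p + 1) * v⌋) :
    min b (1 - 2 * b) ≤ e - Okamoto b (Int.fract ((3:ℝ) ^ p * u))
      + Okamoto b (Int.fract ((3:ℝ) ^ p * v)) := by
  obtain ⟨h1, h2⟩ := tDigit_spec hu1 p
  obtain ⟨h3, h4⟩ := tDigit_spec hv1 p
  have a1 := (okamoto_first_digit hb hb' (Int.fract_lt_one ((3:ℝ) ^ p * u))).2
  have a2 := (okamoto_first_digit hb hb' (Int.fract_lt_one ((3:ℝ) ^ p * v))).1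
  rw [tDigit_fract hu1, zero_add] at a1
  rw [tDigit_fract hv1, zero_add] at a2
  have hm1 := min_le_left b (1 - 2 * b)
  have hm2 := min_le_right b (1 - 2 * b)
  generalize tDigit u p = du at *
  generalize tDigit v p = dv at *
  interval_cases e
  · have hd : du = 0 ∧ dv = 2 := by push_cast at h; omega
    rw [hd.1] at a1
    rw [hd.2] at a2
    simp [qDig] at a1 a2 ⊢
    linarith
  · have hd : du ≤ dv + 1 := by push_cast at h; omega
    interval_cases du <;> interval_cases dv <;>
      first
      | omega
      | (simp only [qDig] at a1 a2
         norm_num at a1 a2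
         push_cast
         linarith)

lemma iteratedDeriv_eval (P : Polynomial ℝ) (k : ℕ) (a : ℝ) :
    iteratedDeriv k (fun b => P.eval b) a = (Polynomial.derivative^[k] P).eval a := by
  induction k generalizing a with
  | zero => simp
  | succ k ih =>
    rw [iteratedDeriv_succ, funext ih, Polynomial.deriv, Function.iterate_succ_apply']

lemma contDiffAt_eval (P : Polynomial ℝ) (k : ℕ) (a : ℝ) :
    ContDiffAt ℝ k (fun b => P.eval b) a := by
  simpa using (P.contDiff_aeval (R := ℝ) (𝕜 := ℝ) k).contDiffAt (x := a)

lemma abs_iteratedDeriv_cylPoly_mul_sub_le {a : ℝ} (ha : 0 < a) (ha' : a < 1 / 2) (k : ℕ) :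
    ∃ C : ℝ, 0 < C ∧ ∀ n l : ℕ, 1 ≤ n → l ≤ n → ∀ x,
      (√n + |(1 - 2 * a) * n - l|) *
        |iteratedDeriv k (fun b => (cylPoly n l).eval b * Okamoto b x) a
          - (Polynomial.derivative^[k] (cylPoly n l)).eval a * Okamoto a x|
        ≤ C * (√n + |(1 - 2 * a) * n - l|) ^ k * (cylPoly n l).eval a := by
  choose C hC HC using fun j => abs_iterate_derivative_cylPoly_le ha ha' j
  choose B hB HB using fun j => (okamoto_contDiffAt_and_bound ha ha' j).2
  refine ⟨(∑ j ∈ Finset.range k, (k.choose j : ℝ) * C j * B (k - j)) + 1, ?_,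
    fun n l hn hl x => ?_⟩
  · have : 0 ≤ ∑ j ∈ Finset.range k, (k.choose j : ℝ) * C j * B (k - j) :=
      Finset.sum_nonneg fun j _ => by have := hC j; have := hB (k - j); positivity
    linarith
  · rw [iteratedDeriv_fun_mul (contDiffAt_eval _ k a)
      ((okamoto_contDiffAt_and_bound ha ha' k).1 x), Finset.sum_range_succ]
    simp only [iteratedDeriv_eval, Nat.choose_self, Nat.cast_one, one_mul, Nat.sub_self,
      iteratedDeriv_zero, add_sub_cancel_right]
    have hP := eval_cylPoly_pos n l ha ha'
    have hs : 1 ≤ √(n:ℝ) := Real.one_le_sqrt.2 (by exact_mod_cast hn)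
    have hT : 1 ≤ √n + |(1 - 2 * a) * n - l| := by
      have := abs_nonneg ((1 - 2 * a) * n - l)
      linarith
    have HCn := fun j => HC j n l hn hl
    set T := √n + |(1 - 2 * a) * n - l|
    set P := (cylPoly n l).eval a
    calc T * |∑ j ∈ Finset.range k, (k.choose j : ℝ) *
            (Polynomial.derivative^[j] (cylPoly n l)).eval a *
            iteratedDeriv (k - j) (fun b => Okamoto b x) a|
        ≤ T * ∑ j ∈ Finset.range k, (k.choose j : ℝ) * (C j * T ^ j * P) * B (k - j) := by
          gcongr
          refine (Finset.abs_sum_le_sum_abs _ _).trans (Finset.sum_le_sum fun j _ => ?_)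
          rw [abs_mul, abs_mul, Nat.abs_cast]
          have := HCn j
          have := HB (k - j) x
          have := hC j
          gcongr
      _ = ∑ j ∈ Finset.range k, (k.choose j : ℝ) * C j * B (k - j) * (T ^ (j + 1) * P) := by
          rw [Finset.mul_sum]
          exact Finset.sum_congr rfl fun j _ => by ring
      _ ≤ ∑ j ∈ Finset.range k, (k.choose j : ℝ) * C j * B (k - j) * (T ^ k * P) := by
          refine Finset.sum_le_sum fun j hj => ?_
          have h1 : T ^ (j + 1) ≤ T ^ k :=
            pow_le_pow_right₀ hT (by have := Finset.mem_range.1 hj; omega)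
          have := hC j
          have := hB (k - j)
          gcongr
      _ ≤ _ := by
          rw [← Finset.sum_mul]
          have : 0 ≤ T ^ k * P := by positivity
          linarith

lemma Mfun_sub {a : ℝ} (ha : 0 < a) (ha' : a < 1 / 2) (k : ℕ) {u v : ℝ} (hu1 : u < 1)
    (hv1 : v < 1) (hu : 0 ≤ u) (hv : 0 ≤ v) (p : ℕ) {e : ℕ} (he : e ≤ 1)
    (h : ⌊(3:ℝ) ^ p * v⌋ = ⌊(3:ℝ) ^ p * u⌋ + e) :
    Mfun k a v - Mfun k a u
      = e * (Polynomial.derivative^[k] (cylPoly p (lCount u p))).eval a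
      - iteratedDeriv k (fun b => (cylPoly p (lCount u p)).eval b *
          Okamoto b (Int.fract ((3:ℝ) ^ p * u))) a
      + iteratedDeriv k (fun b => (cylPoly p (lCount v p)).eval b *
          Okamoto b (Int.fract ((3:ℝ) ^ p * v))) a := by
  have hO := (okamoto_contDiffAt_and_bound ha ha' k).1
  have hu2 := (contDiffAt_eval (cylPoly p (lCount u p)) k a).mul
    (hO (Int.fract ((3:ℝ) ^ p * u)))
  have hv2 := (contDiffAt_eval (cylPoly p (lCount v p)) k a).mul
    (hO (Int.fract ((3:ℝ) ^ p * v)))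
  have he2 := contDiffAt_const (c := (e:ℝ)).mul (contDiffAt_eval (cylPoly p (lCount u p)) k a)
  rw [Mfun, Mfun, ← iteratedDeriv_fun_sub (hO v) (hO u), ← iteratedDeriv_eval,
    ← iteratedDeriv_const_mul _ (contDiffAt_eval _ k a), ← iteratedDeriv_fun_sub he2 hu2,
    ← iteratedDeriv_fun_add (he2.sub hu2) hv2]
  refine Filter.EventuallyEq.iteratedDeriv_eq k ?_
  filter_upwards [Ioo_mem_nhds ha ha'] with b hb
  exact okamoto_sub hb.1 hb.2 hu1 hv1 hu hv p he h

lemma exists_level {u v : ℝ} (hu : 0 ≤ u) (huv : u < v) (hv : v < 1) :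
    ∃ p e : ℕ, e ≤ 1 ∧ ⌊(3:ℝ) ^ p * v⌋ = ⌊(3:ℝ) ^ p * u⌋ + e ∧
      ⌊(3:ℝ) ^ (p + 1) * u⌋ + 2 ≤ ⌊(3:ℝ) ^ (p + 1) * v⌋ := by
  classical
  have hex : ∃ m : ℕ, ⌊(3:ℝ) ^ m * u⌋ + 2 ≤ ⌊(3:ℝ) ^ m * v⌋ := by
    obtain ⟨m, hm⟩ := pow_unbounded_of_one_lt (3 / (v - u)) (by norm_num : (1:ℝ) < 3)
    refine ⟨m, ?_⟩
    rw [div_lt_iff₀ (by linarith)] at hm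
    have := Int.floor_le ((3:ℝ) ^ m * u)
    rw [Int.le_floor]
    push_cast
    linarith
  obtain ⟨p, hp⟩ : ∃ p, Nat.find hex = p + 1 := by
    refine Nat.exists_eq_succ_of_ne_zero fun h0 => ?_
    have := Nat.find_spec hex
    rw [h0] at this
    have e1 : ⌊u⌋ = 0 := Int.floor_eq_zero_iff.2 ⟨hu, by linarith⟩
    have e2 : ⌊v⌋ = 0 := Int.floor_eq_zero_iff.2 ⟨by linarith, hv⟩
    simp [e1, e2] at this
  have h1 := Nat.find_spec hex
  have h2 := Nat.find_min hex (show p < Nat.find hex by omega)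
  rw [hp] at h1
  have h3 : ⌊(3:ℝ) ^ p * u⌋ ≤ ⌊(3:ℝ) ^ p * v⌋ := Int.floor_le_floor (by gcongr)
  exact ⟨p, (⌊(3:ℝ) ^ p * v⌋ - ⌊(3:ℝ) ^ p * u⌋).toNat, by omega, by omega, h1⟩

lemma level_bounds {u v : ℝ} {p e : ℕ} (he : e ≤ 1)
    (h : ⌊(3:ℝ) ^ p * v⌋ = ⌊(3:ℝ) ^ p * u⌋ + e)
    (h' : ⌊(3:ℝ) ^ (p + 1) * u⌋ + 2 ≤ ⌊(3:ℝ) ^ (p + 1) * v⌋) :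
    (3:ℝ) ^ p * (v - u) ≤ 2 ∧ 1 ≤ (3:ℝ) ^ (p + 1) * (v - u) := by
  have a1 := Int.floor_le ((3:ℝ) ^ p * u)
  have a2 := Int.lt_floor_add_one ((3:ℝ) ^ p * v)
  have a3 := Int.lt_floor_add_one ((3:ℝ) ^ (p + 1) * u)
  have a4 := Int.floor_le ((3:ℝ) ^ (p + 1) * v)
  have h1 : (⌊(3:ℝ) ^ p * v⌋ : ℝ) = ⌊(3:ℝ) ^ p * u⌋ + e := by exact_mod_cast h
  have h2 : (⌊(3:ℝ) ^ (p + 1) * u⌋ : ℝ) + 2 ≤ ⌊(3:ℝ) ^ (p + 1) * v⌋ := by exact_mod_cast h'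
  have h3 : (e:ℝ) ≤ 1 := by exact_mod_cast he
  constructor <;> linarith

lemma cylPoly_ratio {a : ℝ} (ha : 0 < a) (ha' : a < 1 / 2) :
    ∃ Λ : ℝ, 1 ≤ Λ ∧ ∀ n l m : ℕ, l ≤ n → m ≤ n → l ≤ m + 1 → m ≤ l + 1 →
      (cylPoly n l).eval a ≤ Λ * (cylPoly n m).eval a := by
  have h1 : 0 < 1 - 2 * a := by linarith
  refine ⟨1 + a / (1 - 2 * a) + (1 - 2 * a) / a, ?_, fun n l m hl hm h h' => ?_⟩
  · have : 0 ≤ a / (1 - 2 * a) + (1 - 2 * a) / a := by positivity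
    linarith
  have hstep : ∀ j, j + 1 ≤ n → (cylPoly n j).eval a * (1 - 2 * a)
      = (cylPoly n (j + 1)).eval a * a := fun j hj => by
    rw [eval_cylPoly, eval_cylPoly, show n - j = n - (j + 1) + 1 by omega]; ring
  have hpos := eval_cylPoly_pos n m ha ha'
  have hA : 0 ≤ a / (1 - 2 * a) * (cylPoly n m).eval a := by positivity
  have hB : 0 ≤ (1 - 2 * a) / a * (cylPoly n m).eval a := by positivity
  rcases (by omega : l = m ∨ l = m + 1 ∨ m = l + 1) with rfl | rfl | rfl
  · nlinarith
  · have : (cylPoly n (m + 1)).eval a = (1 - 2 * a) / a * (cylPoly n m).eval a := by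
      rw [div_mul_eq_mul_div, eq_div_iff ha.ne', ← hstep m hl]
      ring
    rw [this]; linarith
  · have : (cylPoly n l).eval a = a / (1 - 2 * a) * (cylPoly n (l + 1)).eval a := by
      rw [div_mul_eq_mul_div, eq_div_iff h1.ne', hstep l hm]
      ring
    rw [this]; linarith

/-- If `u < v` separate exactly at level `p`, and the `k`-th derivatives of the increments over
the triadic intervals of level `p` containing `u` and `v` have sign `σ` and large size, then
`M_{k,a}(v) - M_{k,a}(u)` has sign `σ` and is comparably large. -/
lemma le_Mfun_sub {a : ℝ} (ha : 0 < a) (ha' : a < 1 / 2) {k : ℕ} (hk : 1 ≤ k) {c : ℝ}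
    (hc : 0 < c) :
    ∃ c' : ℝ, 0 < c' ∧ ∃ N : ℕ, ∀ p : ℕ, N ≤ p → ∀ u v : ℝ, 0 ≤ u → u < v → v < 1 →
      ∀ e : ℕ, e ≤ 1 → ⌊(3:ℝ) ^ p * v⌋ = ⌊(3:ℝ) ^ p * u⌋ + e →
      ⌊(3:ℝ) ^ (p + 1) * u⌋ + 2 ≤ ⌊(3:ℝ) ^ (p + 1) * v⌋ →
      ∀ m : ℕ, m ≤ p → lCount u p ≤ m + 1 → m ≤ lCount u p + 1 → lCount v p ≤ m + 1 →
      m ≤ lCount v p + 1 → ∀ σ : ℝ, |σ| = 1 →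
      (∀ l : ℕ, l ≤ p → l ≤ m + 1 → m ≤ l + 1 →
        c * (√p + |(1 - 2 * a) * p - l|) ^ k * (cylPoly p l).eval a
          ≤ σ * (Polynomial.derivative^[k] (cylPoly p l)).eval a) →
      c' * √p * (cylPoly p m).eval a ≤ σ * (Mfun k a v - Mfun k a u) := by
  obtain ⟨Λ, hΛ, HΛ⟩ := cylPoly_ratio ha ha'
  obtain ⟨C, hC, HC⟩ := abs_iteratedDeriv_cylPoly_mul_sub_le ha ha' k
  obtain ⟨k, rfl⟩ : ∃ j, k = j + 1 := Nat.exists_eq_succ_of_ne_zero (by omega)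
  set μ := min a (1 - 2 * a) with hμ
  have hμpos : 0 < μ := lt_min ha (by linarith)
  have hΛ0 : 0 < Λ := by linarith
  set c₁ := μ * c / (2 ^ (k + 1) * Λ) with hc₁
  have hc₁pos : 0 < c₁ := by positivity
  set C₁ := 2 * C * 2 ^ k * Λ with hC₁
  obtain ⟨N, hN⟩ := exists_nat_ge ((2 * C₁ / c₁) ^ 2)
  refine ⟨c₁ / 2, by positivity, max N 1, fun p hp u v hu huv hv e he h h' m hm hum hmu hvm hmv
    σ hσ hlow => ?_⟩
  have hp1 : 1 ≤ p := (le_max_right _ _).trans hp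
  have hpN : (N:ℝ) ≤ p := by exact_mod_cast (le_max_left _ _).trans hp
  have hs : 1 ≤ √(p:ℝ) := Real.one_le_sqrt.2 (by exact_mod_cast hp1)
  have hsC : 2 * C₁ / c₁ ≤ √(p:ℝ) := Real.le_sqrt_of_sq_le (hN.trans hpN)
  set Tm := √p + |(1 - 2 * a) * p - m| with hTm
  set Pm := (cylPoly p m).eval a with hPm
  have hPmpos : 0 < Pm := eval_cylPoly_pos p m ha ha'
  have hTms : √p ≤ Tm := by have := abs_nonneg ((1 - 2 * a) * p - m); linarith
  have hTm1 : 1 ≤ Tm := hs.trans hTms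
  have hTpos : 0 < Tm := by linarith
  have hTcomp : ∀ l l' : ℕ, l ≤ l' + 1 → l' ≤ l + 1 →
      √p + |(1 - 2 * a) * p - l| ≤ 2 * (√p + |(1 - 2 * a) * p - l'|) := by
    intro l l' h1 h2
    have h1' : (l:ℝ) ≤ l' + 1 := by exact_mod_cast h1
    have h2' : (l':ℝ) ≤ l + 1 := by exact_mod_cast h2
    have h3 : |(l':ℝ) - l| ≤ 1 := abs_le.2 ⟨by linarith, by linarith⟩
    have h4 := abs_add_le ((1 - 2 * a) * p - l') ((l':ℝ) - l)
    have h5 : (1 - 2 * a) * p - l' + ((l':ℝ) - l) = (1 - 2 * a) * p - l := by ring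
    rw [h5] at h4
    have := abs_nonneg ((1 - 2 * a) * p - l')
    linarith
  -- main terms
  have hmain : ∀ l : ℕ, l ≤ p → l ≤ m + 1 → m ≤ l + 1 →
      c / (2 ^ (k + 1) * Λ) * Tm ^ (k + 1) * Pm
        ≤ σ * (Polynomial.derivative^[k + 1] (cylPoly p l)).eval a := by
    intro l hl h1 h2
    refine le_trans ?_ (hlow l hl h1 h2)
    have e1 := hTcomp m l h2 h1
    have e2 := HΛ p m l hm hl h2 h1
    have e3 := eval_cylPoly_pos p l ha ha'
    calc c / (2 ^ (k + 1) * Λ) * Tm ^ (k + 1) * Pm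
        ≤ c / (2 ^ (k + 1) * Λ) * (2 * (√p + |(1 - 2 * a) * p - l|)) ^ (k + 1)
          * (Λ * (cylPoly p l).eval a) := by gcongr
      _ = _ := by rw [mul_pow]; field_simp
  -- error terms
  have herr : ∀ l : ℕ, l ≤ p → l ≤ m + 1 → m ≤ l + 1 → ∀ x,
      |iteratedDeriv (k + 1) (fun b => (cylPoly p l).eval b * Okamoto b x) a
          - (Polynomial.derivative^[k + 1] (cylPoly p l)).eval a * Okamoto a x|
        ≤ C₁ / 2 * Tm ^ k * Pm := by
    intro l hl h1 h2 x
    have e0 := HC p l hp1 hl x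
    have e1 := hTcomp l m h1 h2
    have e2 := HΛ p l m hl hm h1 h2
    have e3 := eval_cylPoly_pos p l ha ha'
    have e4 : 0 < √p + |(1 - 2 * a) * p - l| := by positivity
    rw [pow_succ', ← mul_assoc, mul_comm C, mul_assoc, mul_assoc] at e0
    have e5 := le_of_mul_le_mul_left e0 e4
    refine e5.trans ?_
    calc C * ((√p + |(1 - 2 * a) * p - l|) ^ k * (cylPoly p l).eval a)
        ≤ C * ((2 * Tm) ^ k * (Λ * Pm)) := by gcongr
      _ = _ := by rw [mul_pow, hC₁]; ring
  have hu1 : u < 1 := huv.trans hv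
  have hlu := lCount_le u p
  have hlv := lCount_le v p
  have gap := okamoto_gap ha ha' hu1 hv p he h h'
  have Fu0 := okamoto_nonneg ha ha' (Int.fract ((3:ℝ) ^ p * u))
  have Fu1 := okamoto_le_one ha ha' (Int.fract_lt_one ((3:ℝ) ^ p * u))
  have Fv0 := okamoto_nonneg ha ha' (Int.fract ((3:ℝ) ^ p * v))
  have Eu := herr _ hlu hum hmu (Int.fract ((3:ℝ) ^ p * u))
  have Ev := herr _ hlv hvm hmv (Int.fract ((3:ℝ) ^ p * v))
  have Mu := hmain _ hlu hum hmu
  have Mv := hmain _ hlv hvm hmv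
  have hsub := Mfun_sub ha ha' (k + 1) hu1 hv hu (hu.trans huv.le) p he h
  have hsame : e = 0 → lCount v p = lCount u p := fun h0 =>
    (same_interval hu1 hv p (by rw [h, h0]; simp) a).1
  rw [hsub]
  set Fu := Okamoto a (Int.fract ((3:ℝ) ^ p * u))
  set Fv := Okamoto a (Int.fract ((3:ℝ) ^ p * v))
  set Iu := iteratedDeriv (k + 1) (fun b => (cylPoly p (lCount u p)).eval b *
          Okamoto b (Int.fract ((3:ℝ) ^ p * u))) a
  set Iv := iteratedDeriv (k + 1) (fun b => (cylPoly p (lCount v p)).eval b *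
          Okamoto b (Int.fract ((3:ℝ) ^ p * v))) a
  set A := c / (2 ^ (k + 1) * Λ) * Tm ^ (k + 1) * Pm with hA
  have hApos : 0 < A := by positivity
  have hlead : μ * A ≤ σ * ((Polynomial.derivative^[k + 1] (cylPoly p (lCount u p))).eval a
      * (e - Fu) + (Polynomial.derivative^[k + 1] (cylPoly p (lCount v p))).eval a * Fv) := by
    interval_cases e
    · rw [hsame rfl]
      set Q := (Polynomial.derivative^[k + 1] (cylPoly p (lCount u p))).eval a
      push_cast at gap ⊢
      calc μ * A ≤ (0 - Fu + Fv) * (σ * Q) := by gcongr; linarith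
        _ = _ := by ring
    · set Qu := (Polynomial.derivative^[k + 1] (cylPoly p (lCount u p))).eval a
      set Qv := (Polynomial.derivative^[k + 1] (cylPoly p (lCount v p))).eval a
      push_cast at gap ⊢
      have h1 : (1 - Fu) * A ≤ (1 - Fu) * (σ * Qu) := by
        apply mul_le_mul_of_nonneg_left Mu; linarith
      have h2 : Fv * A ≤ Fv * (σ * Qv) := mul_le_mul_of_nonneg_left Mv Fv0
      have h3 : μ * A ≤ (1 - Fu + Fv) * A := by gcongr
      linarith
  set Qu := (Polynomial.derivative^[k + 1] (cylPoly p (lCount u p))).eval a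
  set Qv := (Polynomial.derivative^[k + 1] (cylPoly p (lCount v p))).eval a
  have hσle : ∀ z : ℝ, -|z| ≤ σ * z := fun z => by
    have := neg_abs_le (σ * z)
    rwa [abs_mul, hσ, one_mul] at this
  have b1 := hσle (-(Iu - Qu * Fu))
  rw [abs_neg] at b1
  have b2 := hσle (Iv - Qv * Fv)
  have htot : μ * A - C₁ * Tm ^ k * Pm ≤ σ * (e * Qu - Iu + Iv) := by
    have : σ * (e * Qu - Iu + Iv) = σ * (Qu * (e - Fu) + Qv * Fv)
      + σ * (-(Iu - Qu * Fu)) + σ * (Iv - Qv * Fv) := by ring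
    rw [this]
    linarith
  refine le_trans ?_ htot
  have hμA : μ * A = c₁ * Tm * (Tm ^ k * Pm) := by rw [hA, hc₁]; ring
  have hCs : C₁ ≤ c₁ / 2 * √p := by
    rw [div_le_iff₀ hc₁pos] at hsC; linarith
  have hTk : 1 ≤ Tm ^ k := one_le_pow₀ hTm1
  rw [hμA]
  calc c₁ / 2 * √p * Pm ≤ c₁ / 2 * √p * (Tm ^ k * Pm) := by
        gcongr; exact le_mul_of_one_le_left hPmpos.le hTk
    _ ≤ (c₁ * Tm - C₁) * (Tm ^ k * Pm) := by
        gcongr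
        have : c₁ * √p ≤ c₁ * Tm := by gcongr
        linarith
    _ = _ := by ring

lemma eventually_le_slope_Mfun {a : ℝ} (ha : 0 < a) (ha' : a < 1 / 2) {k : ℕ} (hk : 1 ≤ k)
    {x : ℝ} (hx : x ∈ Ioo (0:ℝ) 1) (hstar : condStar a x) {c : ℝ} (hc : 0 < c) {σ : ℝ}
    (hσ : |σ| = 1)
    (hlow : ∀ᶠ p : ℕ in atTop, ∀ l : ℕ, l ≤ p → l ≤ lCount x p + 1 → lCount x p ≤ l + 1 →
      c * (√p + |(1 - 2 * a) * p - l|) ^ k * (cylPoly p l).eval a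
        ≤ σ * (Polynomial.derivative^[k] (cylPoly p l)).eval a) (K : ℝ) :
    ∀ᶠ y in 𝓝[Icc 0 1 \ {x}] x, K ≤ σ * ((Mfun k a y - Mfun k a x) / (y - x)) := by
  obtain ⟨c', hc', N₁, H⟩ := le_Mfun_sub ha ha' hk hc
  obtain ⟨M, hM⟩ := exists_nat_ge ((2 * K / c') ^ 2)
  obtain ⟨N, hN⟩ := eventually_atTop.1 (hstar.and (hlow.and
    ((eventually_ge_atTop N₁).and (eventually_ge_atTop M))))
  have key : ∀ u v : ℝ, 0 ≤ u → u < v → v < 1 → (x = u ∨ x = v) → v - u < ((3:ℝ) ^ (N + 1))⁻¹ →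
      K * (v - u) ≤ σ * (Mfun k a v - Mfun k a u) := by
    intro u v hu huv hv hxuv hd
    obtain ⟨p, e, he, h, h'⟩ := exists_level hu huv hv
    obtain ⟨b1, b2⟩ := level_bounds he h h'
    have hp : N ≤ p := by
      by_contra! hlt
      have h3 : (3:ℝ) ^ (p + 1) ≤ 3 ^ (N + 1) := pow_le_pow_right₀ (by norm_num) (by omega)
      have : (3:ℝ) ^ (p + 1) * (v - u) < 3 ^ (N + 1) * (3 ^ (N + 1))⁻¹ :=
        mul_lt_mul' h3 hd (by linarith) (by positivity)
      rw [mul_inv_cancel₀ (by positivity)] at this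
      linarith
    obtain ⟨hst, hlo, hp1, hpM⟩ := hN p hp
    have hadj : lCount v p ≤ lCount u p + 1 ∧ lCount u p ≤ lCount v p + 1 := by
      interval_cases e
      · have := (same_interval (huv.trans hv) hv p (by simpa using h) a).1
        omega
      · have := adjacent_interval (huv.trans hv) hv hu (hu.trans huv.le) p (by simpa using h) a
        exact ⟨this.1, this.2.1⟩
    have hmain := H p hp1 u v hu huv hv e he h h' (lCount x p) (lCount_le x p)
      (by rcases hxuv with rfl | rfl <;> omega) (by rcases hxuv with rfl | rfl <;> omega)
      (by rcases hxuv with rfl | rfl <;> omega) (by rcases hxuv with rfl | rfl <;> omega) σ hσ hlo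
    refine le_trans ?_ hmain
    have hsK : 2 * K / c' ≤ √p :=
      Real.le_sqrt_of_sq_le (hM.trans (by exact_mod_cast hpM))
    rw [div_le_iff₀ hc'] at hsK
    have hP := eval_cylPoly_pos p (lCount x p) ha ha'
    rw [mul_assoc, ← eval_cylPoly] at hst
    set P := (cylPoly p (lCount x p)).eval a
    have hvu : v - u ≤ 2 * P := by
      have h3 : (0:ℝ) < 3 ^ p := by positivity
      refine le_of_mul_le_mul_left ?_ h3
      linarith
    have hs0 : 0 ≤ c' / 2 * √p := by positivity
    calc K * (v - u) ≤ c' / 2 * √p * (v - u) := by gcongr; linarith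
      _ ≤ c' / 2 * √p * (2 * P) := by gcongr
      _ = _ := by ring
  have hnear : ∀ᶠ y in 𝓝 x, y < 1 ∧ |y - x| < ((3:ℝ) ^ (N + 1))⁻¹ :=
    (eventually_lt_nhds hx.2).and 
      (Metric.ball_mem_nhds x (show (0:ℝ) < ((3:ℝ) ^ (N + 1))⁻¹ by positivity))
  filter_upwards [nhdsWithin_le_nhds hnear, self_mem_nhdsWithin] with y hy hyS
  obtain ⟨⟨hy0, -⟩, hyx⟩ := hyS
  rw [abs_lt] at hy
  rcases lt_or_gt_of_ne (show y ≠ x from hyx) with hlt | hlt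
  · have := key y x hy0 hlt hx.2 (Or.inr rfl) (by linarith)
    rw [← neg_sub (Mfun k a x), ← neg_sub x, neg_div_neg_eq, ← mul_div_assoc,
      le_div_iff₀ (by linarith)]
    exact this
  · have := key x y hx.1.le hlt hy.1 (Or.inl rfl) (by linarith)
    rw [← mul_div_assoc, le_div_iff₀ (by linarith)]
    exact this

lemma exists_le_of_signs {a : ℝ} (ha : 0 < a) (ha' : a < 1 / 2) {k : ℕ}
    {t : Fin k → ℝ} (ht : Function.Injective t) (hroots : ∀ i, (qPoly k).eval (t i) = 0)
    {s : Fin k → ℝ} (hs : ∀ j, |s j| = 1) {η : ℝ} (hη : 0 < η) :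
    ∃ c : ℝ, 0 < c ∧ ∃ N : ℕ, ∀ n m : ℕ, N ≤ n →
      (∀ j, 2 * η * √n ≤ s j * ((1 - 2 * a) * n - m - t j * √(2 * a * (1 - 2 * a)) * √n)) →
      ∀ l : ℕ, l ≤ n → l ≤ m + 1 → m ≤ l + 1 →
        c * (√n + |(1 - 2 * a) * n - l|) ^ k * (cylPoly n l).eval a
          ≤ (∏ j, s j) * (Polynomial.derivative^[k] (cylPoly n l)).eval a := by
  obtain ⟨c, hc, N, H⟩ := le_iterate_derivative_cylPoly ha ha' ht hroots hη
  obtain ⟨M, hM⟩ := exists_nat_ge ((1 / η) ^ 2)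
  refine ⟨c, hc, max N (M + 1), fun n m hn hD l hl hlm hml => ?_⟩
  have hnN : N ≤ n := (le_max_left _ _).trans hn
  have hnM : M + 1 ≤ n := (le_max_right _ _).trans hn
  have hs1 : 1 ≤ η * √n := by
    have : 1 / η ≤ √n :=
      Real.le_sqrt_of_sq_le (hM.trans (by exact_mod_cast (Nat.le_succ M).trans hnM))
    rwa [div_le_iff₀' hη] at this
  have hD' : ∀ j, η * √n ≤ s j * ((1 - 2 * a) * n - l - t j * √(2 * a * (1 - 2 * a)) * √n) := by
    intro j
    have h1' : (l:ℝ) ≤ m + 1 := by exact_mod_cast hlm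
    have h2' : (m:ℝ) ≤ l + 1 := by exact_mod_cast hml
    have h3 : |s j * ((m:ℝ) - l)| ≤ 1 := by
      rw [abs_mul, hs, one_mul]
      exact abs_le.2 ⟨by linarith, by linarith⟩
    have h4 := (abs_le.1 h3).1
    have := hD j
    linarith
  refine H n l hnN hl (fun j => ?_) _ (by rw [Finset.abs_prod]; simp [hs]) ?_
  · have := (hD' j).trans (le_abs_self _)
    rwa [abs_mul, hs, one_mul] at this
  · rw [← Finset.prod_mul_distrib]
    exact Finset.prod_pos fun j _ => by linarith [hD' j]

lemma prod_ite_neg_one (k m : ℕ) (hm : m ≤ k) :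
    ∏ j : Fin k, (if (j:ℕ) < m then (1:ℝ) else -1) = (-1) ^ (k - m) := by
  induction k with
  | zero => simp
  | succ k ih =>
    rw [Fin.prod_univ_castSucc]
    rcases hm.eq_or_lt with rfl | h
    · have : ∀ j : Fin k, (j:ℕ) < k + 1 := fun j => by omega
      simp [this]
    · have hm' : m ≤ k := by omega
      rw [show k + 1 - m = (k - m) + 1 by omega, pow_succ, ← ih hm']
      simp [show ¬ k < m by omega]

lemma abs_ite_neg_one {p : Prop} [Decidable p] : |(if p then (1:ℝ) else -1)| = 1 := by
  split_ifs <;> simp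

lemma exists_pos_forall_le {ι : Type*} [Finite ι] {f : ι → ℝ} (hf : ∀ j, 0 < f j) :
    ∃ ε, 0 < ε ∧ ∀ j, ε ≤ f j := by
  have h : ∀ᶠ ε in 𝓝[>] (0:ℝ), ∀ j, ε ∈ Ioc 0 (f j) :=
    eventually_all.2 fun j => Ioc_mem_nhdsGT (hf j)
  obtain ⟨ε, hε, hεj⟩ := ((eventually_mem_nhdsWithin (a := (0:ℝ)) (s := Ioi 0)).and h).exists
  exact ⟨ε, hε, fun j => (hεj j).2⟩

lemma coe_lt_devSeq_iff {a x r : ℝ} {n : ℕ} (hn : 0 < n) :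
    (r : EReal) < devSeq a x n ↔ r * √n < (1 - 2 * a) * n - lCount x n := by
  rw [devSeq, EReal.coe_lt_coe_iff, lt_div_iff₀ (Real.sqrt_pos.2 (by exact_mod_cast hn))]

lemma devSeq_lt_coe_iff {a x r : ℝ} {n : ℕ} (hn : 0 < n) :
    devSeq a x n < (r : EReal) ↔ (1 - 2 * a) * n - lCount x n < r * √n := by
  rw [devSeq, EReal.coe_lt_coe_iff, div_lt_iff₀ (Real.sqrt_pos.2 (by exact_mod_cast hn))]

lemma eventually_le_of_lt_devSeq {a x : ℝ} {k m : ℕ} {τ : Fin k → ℝ}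
    (h1 : ∀ j : Fin k, (j:ℕ) < m → (τ j : EReal) < liminf (devSeq a x) atTop)
    (h2 : ∀ j : Fin k, m ≤ (j:ℕ) → limsup (devSeq a x) atTop < (τ j : EReal)) :
    ∃ η : ℝ, 0 < η ∧ ∀ᶠ n : ℕ in atTop, ∀ j : Fin k, 2 * η * √n ≤
      (if (j:ℕ) < m then (1:ℝ) else -1) * ((1 - 2 * a) * n - lCount x n - τ j * √n) := by
  have h : ∀ j : Fin k, ∃ η : ℝ, 0 < η ∧ ∀ᶠ n : ℕ in atTop, 2 * η * √n ≤
      (if (j:ℕ) < m then (1:ℝ) else -1) * ((1 - 2 * a) * n - lCount x n - τ j * √n) := by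
    intro j
    by_cases hj : (j:ℕ) < m
    · obtain ⟨r, hr1, hr2⟩ := EReal.exists_between_coe_real (h1 j hj)
      have hr1' : τ j < r := by exact_mod_cast hr1
      refine ⟨(r - τ j) / 2, by linarith, ?_⟩
      filter_upwards [eventually_lt_of_lt_liminf hr2, eventually_gt_atTop 0] with n hn hn0
      rw [coe_lt_devSeq_iff hn0] at hn
      rw [if_pos hj]
      linarith
    · obtain ⟨r, hr1, hr2⟩ := EReal.exists_between_coe_real (h2 j (by omega))
      have hr2' : r < τ j := by exact_mod_cast hr2
      refine ⟨(τ j - r) / 2, by linarith, ?_⟩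
      filter_upwards [eventually_lt_of_limsup_lt hr1, eventually_gt_atTop 0] with n hn hn0
      rw [devSeq_lt_coe_iff hn0] at hn
      rw [if_neg hj]
      linarith
  choose η hη H using h
  obtain ⟨ε, hε, hεη⟩ := exists_pos_forall_le hη
  refine ⟨ε, hε, ?_⟩
  filter_upwards [eventually_all.2 H] with n hn j
  refine le_trans ?_ (hn j)
  have := hεη j
  gcongr

/-- If exactly the first `m` normalized roots lie below the range of limit points of `devSeq`
and the others lie above, then the derivative of `M_{k,a}` is infinite of sign `(-1) ^ (k - m)`. -/
lemma infinite_deriv_of_pattern {k : ℕ} (hk : 1 ≤ k) {a : ℝ} (ha : 0 < a) (ha' : a < 1 / 2)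
    {t : Fin k → ℝ} (ht : Function.Injective t) (hroots : ∀ i, (qPoly k).eval (t i) = 0)
    {x : ℝ} (hx : x ∈ Ioo (0:ℝ) 1) (hstar : condStar a x) {m : ℕ} (hm : m ≤ k)
    (h1 : ∀ j : Fin k, (j:ℕ) < m →
      ((t j * √(2 * a * (1 - 2 * a)) : ℝ) : EReal) < liminf (devSeq a x) atTop)
    (h2 : ∀ j : Fin k, m ≤ (j:ℕ) →
      limsup (devSeq a x) atTop < ((t j * √(2 * a * (1 - 2 * a)) : ℝ) : EReal)) :
    if Even (k - m) then derivPInf (Mfun k a) x else derivMInf (Mfun k a) x := by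
  obtain ⟨η, hη, H⟩ := eventually_le_of_lt_devSeq h1 h2
  obtain ⟨c, hc, N, HN⟩ := exists_le_of_signs ha ha' ht hroots
    (s := fun j => if (j:ℕ) < m then (1:ℝ) else -1) (fun j => abs_ite_neg_one) hη
  have hlow : ∀ᶠ p : ℕ in atTop, ∀ l : ℕ, l ≤ p → l ≤ lCount x p + 1 → lCount x p ≤ l + 1 →
      c * (√p + |(1 - 2 * a) * p - l|) ^ k * (cylPoly p l).eval a
        ≤ (-1) ^ (k - m) * (Polynomial.derivative^[k] (cylPoly p l)).eval a := by
    filter_upwards [H, eventually_ge_atTop N] with p hp hpN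
    rw [← prod_ite_neg_one k m hm]
    exact HN p _ hpN hp
  have key := eventually_le_slope_Mfun ha ha' hk hx hstar hc (by simp) hlow
  split_ifs with hev
  · rw [hev.neg_one_pow] at key
    exact tendsto_atTop.2 fun K => by simpa using key K
  · rw [(Nat.not_even_iff_odd.1 hev).neg_one_pow] at key
    refine tendsto_atBot.2 fun K => ?_
    filter_upwards [key (-K)] with y hy
    linarith

lemma condStar_of_abs_le {a : ℝ} (ha : 0 < a) (ha' : a < 1 / 2) {x B : ℝ}
    (hB : ∀ᶠ n : ℕ in atTop, |(1 - 2 * a) * n - lCount x n| ≤ B * √n) : condStar a x := by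
  have hw : 0 < 1 - 2 * a := by linarith
  by_cases h3 : a = 1 / 3
  · refine Eventually.of_forall fun n => ?_
    rw [mul_assoc, show 1 - 2 * a = a by rw [h3]; norm_num, ← pow_add,
      Nat.sub_add_cancel (lCount_le x n), ← mul_pow, h3]
    norm_num
  · set E := Real.log 3 + 2 * a * Real.log a + (1 - 2 * a) * Real.log (1 - 2 * a) with hE
    have hEpos : 0 < E := by
      have e1 : Real.log ((3 * a)⁻¹) < (3 * a)⁻¹ - 1 := by
        refine Real.log_lt_sub_one_of_pos (by positivity) fun h => h3 ?_
        rw [inv_eq_one] at h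
        linarith
      have e2 : Real.log ((3 * (1 - 2 * a))⁻¹) ≤ (3 * (1 - 2 * a))⁻¹ - 1 :=
        Real.log_le_sub_one_of_pos (by positivity)
      rw [Real.log_inv, Real.log_mul (by norm_num) ha.ne'] at e1
      rw [Real.log_inv, Real.log_mul (by norm_num) hw.ne'] at e2
      have e3 : a * (3 * a)⁻¹ = 1 / 3 := by field_simp
      have e4 : (1 - 2 * a) * (3 * (1 - 2 * a))⁻¹ = 1 / 3 := by field_simp
      have e5 := mul_lt_mul_of_pos_left e1 ha
      have e6 := mul_le_mul_of_nonneg_left e2 hw.le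
      rw [mul_sub, e3] at e5
      rw [mul_sub, e4] at e6
      rw [hE]
      linarith
    set lam := Real.log a - Real.log (1 - 2 * a) with hlam
    obtain ⟨M, hM⟩ := exists_nat_ge ((B * |lam| / E) ^ 2)
    filter_upwards [hB, eventually_ge_atTop M] with n hn hnM
    have hs : B * |lam| ≤ √n * E := by
      have : B * |lam| / E ≤ √n := Real.le_sqrt_of_sq_le (hM.trans (by exact_mod_cast hnM))
      rwa [div_le_iff₀ hEpos] at this
    have hsq : √(n:ℝ) * √n = n := Real.mul_self_sqrt (Nat.cast_nonneg n)
    have hpos : (0:ℝ) < 3 ^ n * a ^ (n - lCount x n) * (1 - 2 * a) ^ lCount x n := by positivity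
    rw [← Real.log_nonneg_iff hpos, Real.log_mul (by positivity) (by positivity),
      Real.log_mul (by positivity) (by positivity), Real.log_pow, Real.log_pow, Real.log_pow,
      Nat.cast_sub (lCount_le x n)]
    have hid : n * Real.log 3 + (n - lCount x n) * Real.log a
        + lCount x n * Real.log (1 - 2 * a)
        = n * E + ((1 - 2 * a) * n - lCount x n) * lam := by rw [hE, hlam]; ring
    rw [hid]
    have b1 := neg_abs_le (((1 - 2 * a) * n - lCount x n) * lam)
    rw [abs_mul] at b1
    have b2 := mul_le_mul_of_nonneg_right hn (abs_nonneg lam)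
    have b3 := mul_le_mul_of_nonneg_left hs (Real.sqrt_nonneg n)
    have b4 : √(n:ℝ) * (√n * E) = n * E := by rw [← mul_assoc, hsq]
    linarith

lemma condStar_of_lt_devSeq {a : ℝ} (ha : 0 < a) (ha' : a < 1 / 2) {x r s : ℝ}
    (hr : (r : EReal) < liminf (devSeq a x) atTop)
    (hs : limsup (devSeq a x) atTop < (s : EReal)) : condStar a x := by
  refine condStar_of_abs_le ha ha' (B := max (-r) s) ?_
  filter_upwards [eventually_lt_of_lt_liminf hr, eventually_lt_of_limsup_lt hs,
    eventually_gt_atTop 0] with n h1 h2 hn0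
  have hpos : 0 < √(n:ℝ) := Real.sqrt_pos.2 (by exact_mod_cast hn0)
  rw [coe_lt_devSeq_iff hn0] at h1
  rw [devSeq_lt_coe_iff hn0] at h2
  have b1 := mul_le_mul_of_nonneg_right (le_max_left (-r) s) hpos.le
  have b2 := mul_le_mul_of_nonneg_right (le_max_right (-r) s) hpos.le
  exact abs_le.2 ⟨by linarith, by linarith⟩

lemma Okamoto_zero (b : ℝ) : Okamoto b 0 = 0 := by
  have h : ∀ n, tDigit 0 n = 0 := fun n => by simp [tDigit]
  simp [Okamoto, h, qDig]

/-- The increment of `M_{k,a}` over the triadic interval of level `n` containing `x`. -/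
lemma Mfun_sub_triadic {a : ℝ} (ha : 0 < a) (ha' : a < 1 / 2) (k : ℕ) {x : ℝ} (hx0 : 0 ≤ x)
    (hx1 : x < 1) {n : ℕ} (hR : ((⌊(3:ℝ) ^ n * x⌋ : ℝ) + 1) / 3 ^ n < 1) :
    Mfun k a (((⌊(3:ℝ) ^ n * x⌋ : ℝ) + 1) / 3 ^ n) - Mfun k a ((⌊(3:ℝ) ^ n * x⌋ : ℝ) / 3 ^ n)
      = (Polynomial.derivative^[k] (cylPoly n (lCount x n))).eval a := by
  set z := ⌊(3:ℝ) ^ n * x⌋ with hz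
  have h3 : (0:ℝ) < 3 ^ n := by positivity
  have hz0 : (0:ℝ) ≤ z := by exact_mod_cast Int.floor_nonneg.2 (by positivity)
  have hL : (z:ℝ) / 3 ^ n < (z + 1) / 3 ^ n := by gcongr; linarith
  have e1 : (3:ℝ) ^ n * (z / 3 ^ n) = z := by field_simp
  have e2 : (3:ℝ) ^ n * ((z + 1) / 3 ^ n) = ((z + 1 : ℤ) : ℝ) := by push_cast; field_simp
  have hl : lCount ((z:ℝ) / 3 ^ n) n = lCount x n :=
    (same_interval hx1 (hL.trans hR) n (by rw [e1, Int.floor_intCast]) a).1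
  rw [Mfun_sub ha ha' k (hL.trans hR) hR (by positivity) (by positivity) n le_rfl
    (by rw [e1, e2, Int.floor_intCast, Int.floor_intCast]; simp), e1, e2, Int.fract_intCast,
    Int.fract_intCast, hl]
  simp [Okamoto_zero]

lemma eventually_sign_iterate_derivative {a : ℝ} (ha : 0 < a) (ha' : a < 1 / 2) {k : ℕ}
    {x : ℝ} (hx : x ∈ Ioo (0:ℝ) 1) {σ : ℝ}
    (h : ∀ᶠ y in 𝓝[Icc 0 1 \ {x}] x, 0 < σ * ((Mfun k a y - Mfun k a x) / (y - x))) :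
    ∀ᶠ n : ℕ in atTop,
      0 < σ * (Polynomial.derivative^[k] (cylPoly n (lCount x n))).eval a := by
  rw [eventually_nhdsWithin_iff, Metric.eventually_nhds_iff] at h
  obtain ⟨ε, hε, h⟩ := h
  have hlim : Tendsto (fun n : ℕ => ((3:ℝ) ^ n)⁻¹) atTop (𝓝 0) := by
    simpa using tendsto_pow_atTop_nhds_zero_of_lt_one (r := (3:ℝ)⁻¹) (by norm_num) (by norm_num)
  filter_upwards [hlim.eventually (gt_mem_nhds hε),
    hlim.eventually (gt_mem_nhds (show 0 < 1 - x by linarith [hx.2]))] with n h1 h2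
  have h3 : (0:ℝ) < 3 ^ n := by positivity
  have hz0 : (0:ℝ) ≤ ⌊(3:ℝ) ^ n * x⌋ := by
    exact_mod_cast Int.floor_nonneg.2 (by have := hx.1; positivity)
  have hfl : (⌊(3:ℝ) ^ n * x⌋ : ℝ) / 3 ^ n ≤ x := by
    rw [div_le_iff₀' h3]; exact Int.floor_le _
  have hfr : x < ((⌊(3:ℝ) ^ n * x⌋ : ℝ) + 1) / 3 ^ n := by
    rw [lt_div_iff₀' h3]; exact Int.lt_floor_add_one _
  have hLR : ((⌊(3:ℝ) ^ n * x⌋ : ℝ) + 1) / 3 ^ n = (⌊(3:ℝ) ^ n * x⌋ : ℝ) / 3 ^ n + (3 ^ n)⁻¹ := by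
    rw [add_div, one_div]
  have hR1 : ((⌊(3:ℝ) ^ n * x⌋ : ℝ) + 1) / 3 ^ n < 1 := by linarith
  rw [← Mfun_sub_triadic ha ha' k hx.1.le hx.2 hR1]
  have hL0 : 0 ≤ (⌊(3:ℝ) ^ n * x⌋ : ℝ) / 3 ^ n := by positivity
  set L := (⌊(3:ℝ) ^ n * x⌋ : ℝ) / 3 ^ n
  set R := ((⌊(3:ℝ) ^ n * x⌋ : ℝ) + 1) / 3 ^ n
  have hright : 0 < σ * (Mfun k a R - Mfun k a x) := by
    have := h (y := R) (by rw [Real.dist_eq, abs_lt]; constructor <;> linarith)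
      ⟨⟨by linarith, hR1.le⟩, hfr.ne'⟩
    rw [← mul_div_assoc] at this
    exact (div_pos_iff_of_pos_right (by linarith)).1 this
  have hleft : 0 ≤ σ * (Mfun k a x - Mfun k a L) := by
    rcases hfl.eq_or_lt with heq | hlt
    · rw [heq]; simp
    · have := h (y := L) (by rw [Real.dist_eq, abs_lt]; constructor <;> linarith)
        ⟨⟨hL0, by linarith⟩, hlt.ne⟩
      rw [← neg_sub (Mfun k a x), ← neg_sub x, neg_div_neg_eq, ← mul_div_assoc] at this
      exact ((div_pos_iff_of_pos_right (by linarith)).1 this).le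
  linarith

/-- A real sequence with upward steps at most `b` that is negative infinitely often and positive
infinitely often is infinitely often in `[-b, b]`. -/
lemma frequently_abs_le_of_step {f : ℕ → ℝ} {b : ℝ} (hstep : ∀ n, f (n + 1) ≤ f n + b)
    (hneg : ∃ᶠ n in atTop, f n < 0) (hpos : ∃ᶠ n in atTop, 0 < f n) :
    ∃ᶠ n in atTop, |f n| ≤ b := by
  classical
  rw [frequently_atTop] at hneg hpos ⊢
  intro N
  obtain ⟨p, hpN, hp⟩ := hneg N
  have hex : ∃ d, 0 ≤ f (p + d) := by
    obtain ⟨q, hq, hq'⟩ := hpos p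
    exact ⟨q - p, by rw [Nat.add_sub_cancel' hq]; exact hq'.le⟩
  have h0 : Nat.find hex ≠ 0 := fun h => by
    have := Nat.find_spec hex
    rw [h, add_zero] at this
    linarith
  obtain ⟨d, hd⟩ := Nat.exists_eq_succ_of_ne_zero h0
  have h1 := Nat.find_spec hex
  have h2 := Nat.find_min hex (show d < Nat.find hex by omega)
  rw [hd] at h1
  have h3 := hstep (p + d)
  refine ⟨p + (d + 1), by omega, ?_⟩
  rw [abs_of_nonneg h1]
  exact h3.trans (by linarith)

lemma frequently_abs_sub_le {a : ℝ} (ha : 0 < a) {x r : ℝ}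
    (h1 : liminf (devSeq a x) atTop < (r : EReal))
    (h2 : (r : EReal) < limsup (devSeq a x) atTop) :
    ∃ᶠ n : ℕ in atTop, |(1 - 2 * a) * n - lCount x n - r * √n| ≤ 1 + |r| := by
  refine frequently_abs_le_of_step (f := fun n : ℕ => (1 - 2 * a) * n - lCount x n - r * √n)
    (fun n => ?_) ?_ ?_
  · have e1 : (lCount x n : ℝ) ≤ lCount x (n + 1) := by
      rw [lCount_succ]; push_cast; split_ifs <;> simp
    have e2 : √(n:ℝ) ≤ √((n + 1 : ℕ) : ℝ) := Real.sqrt_le_sqrt (by simp)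
    have e3 : √((n + 1 : ℕ) : ℝ) ≤ √n + 1 := by
      rw [Real.sqrt_le_left (by positivity)]
      have := Real.sq_sqrt (Nat.cast_nonneg (α := ℝ) n)
      have := Real.sqrt_nonneg (n:ℝ)
      push_cast
      nlinarith
    have e4 : -(r * (√((n + 1 : ℕ) : ℝ) - √n)) ≤ |r| := by
      refine (neg_le_abs _).trans ?_
      rw [abs_mul, abs_of_nonneg (sub_nonneg.2 e2)]
      exact mul_le_of_le_one_right (abs_nonneg r) (by linarith)
    push_cast at e4 ⊢
    linarith
  · refine ((frequently_lt_of_liminf_lt (by isBoundedDefault) h1).and_eventually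
      (eventually_gt_atTop 0)).mono fun n hn => ?_
    have := (devSeq_lt_coe_iff hn.2).1 hn.1
    linarith
  · refine ((frequently_lt_of_lt_limsup (by isBoundedDefault) h2).and_eventually
      (eventually_gt_atTop 0)).mono fun n hn => ?_
    have := (coe_lt_devSeq_iff hn.2).1 hn.1
    linarith

lemma frequently_sign_iterate_derivative {a : ℝ} (ha : 0 < a) (ha' : a < 1 / 2) {k : ℕ}
    {t : Fin k → ℝ} (ht : Function.Injective t) (hroots : ∀ i, (qPoly k).eval (t i) = 0)
    {x r : ℝ} {m : ℕ} (hm : m ≤ k) (hlow : liminf (devSeq a x) atTop < (r : EReal))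
    (hupp : (r : EReal) < limsup (devSeq a x) atTop)
    (h1 : ∀ j : Fin k, (j:ℕ) < m → t j * √(2 * a * (1 - 2 * a)) < r)
    (h2 : ∀ j : Fin k, m ≤ (j:ℕ) → r < t j * √(2 * a * (1 - 2 * a))) :
    ∃ᶠ n : ℕ in atTop,
      0 < (-1) ^ (k - m) * (Polynomial.derivative^[k] (cylPoly n (lCount x n))).eval a := by
  have hpos : ∀ j : Fin k,
      0 < (if (j:ℕ) < m then (1:ℝ) else -1) * (r - t j * √(2 * a * (1 - 2 * a))) := by
    intro j
    split_ifs with hj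
    · linarith [h1 j hj]
    · linarith [h2 j (by omega)]
  obtain ⟨ε, hε0, hεj⟩ := exists_pos_forall_le hpos
  obtain ⟨c, hc, N, HN⟩ := exists_le_of_signs ha ha' ht hroots
    (s := fun j => if (j:ℕ) < m then (1:ℝ) else -1) (fun j => abs_ite_neg_one)
    (show 0 < ε / 4 by positivity)
  obtain ⟨M, hM⟩ := exists_nat_ge ((2 * (1 + |r|) / ε) ^ 2)
  refine ((frequently_abs_sub_le ha hlow hupp).and_eventually
    ((eventually_ge_atTop N).and ((eventually_ge_atTop M).and (eventually_gt_atTop 0)))).mono ?_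
  rintro n ⟨hn, hnN, hnM, hn0⟩
  have hs : 0 < √(n:ℝ) := Real.sqrt_pos.2 (by exact_mod_cast hn0)
  have hsM : 2 * (1 + |r|) ≤ √n * ε := by
    have : 2 * (1 + |r|) / ε ≤ √n := Real.le_sqrt_of_sq_le (hM.trans (by exact_mod_cast hnM))
    rwa [div_le_iff₀ hε0] at this
  rw [← prod_ite_neg_one k m hm]
  refine lt_of_lt_of_le ?_ (HN n (lCount x n) hnN (fun j => ?_) (lCount x n) (lCount_le x n)
    (by omega) (by omega))
  · have := eval_cylPoly_pos n (lCount x n) ha ha'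
    positivity
  · have e1 := mul_le_mul_of_nonneg_right (hεj j) hs.le
    set s : ℝ := if (j:ℕ) < m then (1:ℝ) else -1 with hsdef
    have e2 := neg_abs_le (s * ((1 - 2 * a) * n - lCount x n - r * √n))
    rw [abs_mul, hsdef, abs_ite_neg_one, one_mul, ← hsdef] at e2
    linarith

lemma not_eventually_sign_slope {k : ℕ} {a : ℝ} (ha : 0 < a) (ha' : a < 1 / 2)
    {t : Fin k → ℝ} (ht : StrictMono t) (hroots : ∀ i, (qPoly k).eval (t i) = 0)
    {x : ℝ} (hx : x ∈ Ioo (0:ℝ) 1) (i : Fin k)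
    (h1 : liminf (devSeq a x) atTop < ((t i * √(2 * a * (1 - 2 * a)) : ℝ) : EReal))
    (h2 : ((t i * √(2 * a * (1 - 2 * a)) : ℝ) : EReal) < limsup (devSeq a x) atTop) (σ : ℝ) :
    ¬ ∀ᶠ y in 𝓝[Icc 0 1 \ {x}] x, 0 < σ * ((Mfun k a y - Mfun k a x) / (y - x)) := by
  intro h
  have hσ := eventually_sign_iterate_derivative ha ha' hx h
  have hw : 0 < √(2 * a * (1 - 2 * a)) :=
    Real.sqrt_pos.2 (mul_pos (by linarith) (by linarith))
  have hτ : StrictMono fun j => t j * √(2 * a * (1 - 2 * a)) :=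
    fun p q hpq => mul_lt_mul_of_pos_right (ht hpq) hw
  have hlim : Tendsto (fun r : ℝ => (r : EReal)) (𝓝 (t i * √(2 * a * (1 - 2 * a))))
      (𝓝 ((t i * √(2 * a * (1 - 2 * a)) : ℝ) : EReal)) :=
    continuous_coe_real_ereal.continuousAt
  have hbet := (hlim.eventually (lt_mem_nhds h1)).and (hlim.eventually (gt_mem_nhds h2))
  have hbelow : ∀ᶠ r in 𝓝 (t i * √(2 * a * (1 - 2 * a))),
      ∀ j, j < i → t j * √(2 * a * (1 - 2 * a)) < r :=
    eventually_all.2 fun j => by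
      by_cases hj : j < i
      · simpa [hj] using lt_mem_nhds (hτ hj)
      · simp [hj]
  have habove : ∀ᶠ r in 𝓝 (t i * √(2 * a * (1 - 2 * a))),
      ∀ j, i < j → r < t j * √(2 * a * (1 - 2 * a)) :=
    eventually_all.2 fun j => by
      by_cases hj : i < j
      · simpa [hj] using gt_mem_nhds (hτ hj)
      · simp [hj]
  obtain ⟨r₁, ⟨⟨hl₁, hu₁⟩, hb⟩, hr₁⟩ := (((hbet.and hbelow).filter_mono nhdsWithin_le_nhds).and
    (eventually_mem_nhdsWithin (s := Iio (t i * √(2 * a * (1 - 2 * a)))))).exists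
  obtain ⟨r₂, ⟨⟨hl₂, hu₂⟩, hab⟩, hr₂⟩ := (((hbet.and habove).filter_mono nhdsWithin_le_nhds).and
    (eventually_mem_nhdsWithin (s := Ioi (t i * √(2 * a * (1 - 2 * a)))))).exists
  have hF₁ := frequently_sign_iterate_derivative ha ha' ht.injective hroots (m := i) i.2.le hl₁ hu₁
    (fun j hj => hb j hj) (fun j hj => lt_of_lt_of_le hr₁ (hτ.monotone hj))
  have hF₂ := frequently_sign_iterate_derivative ha ha' ht.injective hroots (m := i + 1) i.2 hl₂ hu₂
    (fun j hj => lt_of_le_of_lt (hτ.monotone (Nat.lt_succ_iff.1 hj)) hr₂) (fun j hj => hab j hj)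
  obtain ⟨n₁, p₁, q₁⟩ := (hF₁.and_eventually hσ).exists
  obtain ⟨n₂, p₂, q₂⟩ := (hF₂.and_eventually hσ).exists
  have hi := i.2
  rw [show k - (i:ℕ) = k - (i + 1) + 1 by omega, pow_succ] at p₁
  rcases neg_one_pow_eq_or ℝ (k - ((i:ℕ) + 1)) with h' | h' <;> rw [h'] at p₁ p₂ <;>
    nlinarith

/-- the alternating pattern of infinite derivatives of `M_{k,a}` for
`0 < a < 1/2`, governed by the roots `t₁ < ⋯ < t_k` of `q_k`. -/
theorem stmt11 (k : ℕ) (hk : 1 ≤ k) (a : ℝ) (ha : 0 < a) (ha' : a < 1/2)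
    (t : Fin k → ℝ) (htmono : StrictMono t)
    (hroots : ∀ s : ℝ, (qPoly k).eval s = 0 ↔ s ∈ Set.range t)
    (x : ℝ) (hx : x ∈ Set.Ioo (0:ℝ) 1) :
    -- (a)
    (condStar a x →
      Filter.limsup (devSeq a x) atTop
          < ((t ⟨0, hk⟩ * Real.sqrt (2 * a * (1 - 2 * a)) : ℝ) : EReal) →
      (if Even k then derivPInf (Mfun k a) x else derivMInf (Mfun k a) x)) ∧
    -- (b)
    (∀ i : ℕ, ∀ hi : i + 1 < k,
      ((t ⟨i, by omega⟩ * Real.sqrt (2 * a * (1 - 2 * a)) : ℝ) : EReal)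
          < Filter.liminf (devSeq a x) atTop →
      Filter.limsup (devSeq a x) atTop
          < ((t ⟨i + 1, hi⟩ * Real.sqrt (2 * a * (1 - 2 * a)) : ℝ) : EReal) →
      (if Even (k - (i + 1)) then derivPInf (Mfun k a) x else derivMInf (Mfun k a) x)) ∧
    -- (c)
    (condStar a x →
      ((t ⟨k - 1, by omega⟩ * Real.sqrt (2 * a * (1 - 2 * a)) : ℝ) : EReal)
          < Filter.liminf (devSeq a x) atTop →
      derivPInf (Mfun k a) x) ∧
    -- (d)
    (∀ i : Fin k,
      Filter.liminf (devSeq a x) atTop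
          < ((t i * Real.sqrt (2 * a * (1 - 2 * a)) : ℝ) : EReal) →
      ((t i * Real.sqrt (2 * a * (1 - 2 * a)) : ℝ) : EReal)
          < Filter.limsup (devSeq a x) atTop →
      ¬ (derivPInf (Mfun k a) x ∨ derivMInf (Mfun k a) x)) := by
  have hr : ∀ i, (qPoly k).eval (t i) = 0 := fun i => (hroots _).2 ⟨i, rfl⟩
  have hτ : StrictMono fun j => t j * √(2 * a * (1 - 2 * a)) := fun p q hpq =>
    mul_lt_mul_of_pos_right (htmono hpq)
      (Real.sqrt_pos.2 (mul_pos (by linarith) (by linarith)))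
  refine ⟨fun hstar h => ?_, fun i hi h1 h2 => ?_, fun hstar h => ?_, fun i h1 h2 => ?_⟩
  · have := infinite_deriv_of_pattern hk ha ha' htmono.injective hr hx hstar (Nat.zero_le k)
      (fun j hj => absurd hj (Nat.not_lt_zero _))
      (fun j _ => h.trans_le (EReal.coe_le_coe_iff.2 (hτ.monotone (Nat.zero_le (j:ℕ)))))
    simpa using this
  · exact infinite_deriv_of_pattern hk ha ha' htmono.injective hr hx
      (condStar_of_lt_devSeq ha ha' h1 h2) hi.le
      (fun j hj => (EReal.coe_le_coe_iff.2 (hτ.monotone (Nat.lt_succ_iff.1 hj))).trans_lt h1)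
      (fun j hj => h2.trans_le (EReal.coe_le_coe_iff.2 (hτ.monotone hj)))
  · have := infinite_deriv_of_pattern hk ha ha' htmono.injective hr hx hstar le_rfl
      (fun j _ => (EReal.coe_le_coe_iff.2 (hτ.monotone (Nat.le_sub_one_of_lt j.2))).trans_lt h)
      (fun j hj => absurd j.2 (not_lt.2 hj))
    simpa using this
  · rintro (h | h)
    · refine not_eventually_sign_slope ha ha' htmono hr hx i h1 h2 1 ?_
      filter_upwards [h.eventually_gt_atTop 0] with y hy
      linarith
    · refine not_eventually_sign_slope ha ha' htmono hr hx i h1 h2 (-1) ?_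
      filter_upwards [h.eventually_lt_atBot 0] with y hy
      linarith
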